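/- For n ∈ ℕ let p = p_n and let 𝒫_n satisfy Condition (C1) with X = X_n ⊆ ℝ^{p_n}. Suppose that for each P ∈ 𝒫_n there is σ_P² ∈ (0,∞) with sup_n sup_{P∈𝒫_n} ‖f_{u/σ_P,P}‖_∞ < ∞, where f_{u/σ_P,P}(s) = σ_P f_{u,P}(sσ_P) is the scaled error density. Assume m̂_n is symmetric and η_n-stable w.r.t. 𝒫_n with η_n → 0, and that its scaled estimation error is 𝒫_n-uniformly bounded in probability: limsup_n sup_{P∈𝒫_n} P^{n+1}(|m_P(x₀) − m̂_n(x₀)|/σ_P > M) → 0 as M → ∞. If the family {f_{u/σ_P,P} : P ∈ 𝒫_n, n ∈ ℕ} is uniformly tight, then (i) sup_{P∈𝒫_n} E_{P^n}[sup_s |F̂_n(s) − F̃_n(s)|] → 0 as n → ∞; and (ii) for any 0 ≤ α₁ < α₂ ≤ 1, sup_{P∈𝒫_n} E_{P^n}[|P^{n+1}(y₀ ∈ PI^{(L1O)}_{α₁,α₂}(T_n,x₀) ‖ T_n) − (α₂ − α₁)|] → 0 as n → ∞. -/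

import Mathlib

open MeasureTheory ProbabilityTheory Filter Topology

noncomputable section

abbrev Vec (p : ℕ) := Fin p → ℝ
abbrev Obs (p : ℕ) := Vec p × ℝ

/-- Remove the `i`-th entry from an `n`-tuple. -/
def erase1 {Z : Type*} {n : ℕ} (T : Fin n → Z) (i : Fin n) (j : Fin (n - 1)) : Z :=
  have hj : (j : ℕ) < n - 1 := j.isLt
  if (j : ℕ) < (i : ℕ) then T ⟨j, by omega⟩ else T ⟨(j : ℕ) + 1, by omega⟩

/-- Remove the first entry from an `n`-tuple. -/
def dropFirst {Z : Type*} {n : ℕ} (T : Fin n → Z) (j : Fin (n - 1)) : Z :=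
  have hj : (j : ℕ) < n - 1 := j.isLt
  T ⟨(j : ℕ) + 1, by omega⟩

/-- The `k`-th smallest entry (0-based, clipped) of a real tuple. -/
def orderStat {n : ℕ} (u : Fin n → ℝ) (k : ℕ) : ℝ :=
  if h : n = 0 then 0 else (u ∘ Tuple.sort u) ⟨min k (n - 1), by omega⟩

/-- Empirical `α`-quantile of a tuple, as in the paper: `û_(⌈nα⌉)` for `α ∈ (0,1]`,
and `û_(1) - e^{-n}` for `α = 0`. -/
def qhat {n : ℕ} (u : Fin n → ℝ) (α : ℝ) : ℝ :=
  if α = 0 then orderStat u 0 - Real.exp (-(n : ℝ)) else orderStat u (⌈(n : ℝ) * α⌉₊ - 1)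

/-- Empirical distribution function of a tuple. -/
def empCDF {n : ℕ} (u : Fin n → ℝ) (s : ℝ) : ℝ :=
  ((Finset.univ.filter fun i : Fin n => u i ≤ s).card : ℝ) / n

/-- Conditional cdf of the prediction error `y₀ - g(x₀)` under `P`. -/
def errCDF {p : ℕ} (P : Measure (Obs p)) (g : Vec p → ℝ) (s : ℝ) : ℝ :=
  (P {z : Obs p | z.2 - g z.1 ≤ s}).toReal

/-- Coverage probability of the interval `(g(x₀)+q₁, g(x₀)+q₂]` under `P`. -/
def coverProb {p : ℕ} (P : Measure (Obs p)) (g : Vec p → ℝ) (q₁ q₂ : ℝ) : ℝ :=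
  (P {z : Obs p | g z.1 + q₁ < z.2 ∧ z.2 ≤ g z.1 + q₂}).toReal

/-- Condition (C1): `m` is the regression function of `P`, the error `u₀ = y₀ - m(x₀)` is
independent of `x₀` and has (bounded, nonnegative) Lebesgue density `f`. -/
def IsC1 {p : ℕ} (P : Measure (Obs p)) (m : Vec p → ℝ) (f : ℝ → ℝ) : Prop :=
  Measurable m ∧ (∀ s, 0 ≤ f s) ∧ BddAbove (Set.range f) ∧
    IndepFun (fun z : Obs p => z.1) (fun z : Obs p => z.2 - m z.1) P ∧
    Measure.map (fun z : Obs p => z.2 - m z.1) P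
      = volume.withDensity (fun s => ENNReal.ofReal (f s)) ∧
    Integrable (fun z : Obs p => z.2 - m z.1) P ∧
    (∫ z, (z.2 - m z.1) ∂P) = 0


/-- Leave-one-out residuals. -/
def looResid {p n : ℕ} (Mloo : (Fin (n - 1) → Obs p) → Vec p → ℝ)
    (T : Fin n → Obs p) (i : Fin n) : ℝ :=
  (T i).2 - Mloo (erase1 T i) (T i).1

/-- The training part of a sample `ω : Fin (n+1) → Z` (coordinate `0` is `z₀`). -/
def train {Z : Type*} {n : ℕ} (ω : Fin (n + 1) → Z) (i : Fin n) : Z := ω i.succ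

/-- A (pair of) learning algorithm(s) is symmetric if invariant under permutations of the
training sample. -/
def SymmetricAlg {p n : ℕ} (Mfull : (Fin n → Obs p) → Vec p → ℝ)
    (Mloo : (Fin (n - 1) → Obs p) → Vec p → ℝ) : Prop :=
  (∀ (T : Fin n → Obs p) (π : Equiv.Perm (Fin n)) (x : Vec p), Mfull (T ∘ π) x = Mfull T x) ∧
  (∀ (T : Fin (n - 1) → Obs p) (π : Equiv.Perm (Fin (n - 1))) (x : Vec p),
    Mloo (T ∘ π) x = Mloo T x)

/-- Prediction error of the predictor `g` at the observation `z`. -/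
def predErr {p : ℕ} (g : Vec p → ℝ) (z : Obs p) : ℝ := z.2 - g z.1

/-- The indicator of `a ≤ b`. -/
def leInd (a b : ℝ) : ℝ := if a ≤ b then 1 else 0

/-- Average truncated distance, at scale `1 / B`, between two predictors. -/
def predDist {p : ℕ} (P : Measure (Obs p)) (B : ℝ) (a b : Vec p → ℝ) : ℝ :=
  ∫ z, min (B * |a z.1 - b z.1|) 1 ∂P

/-- The probability that the response falls between two predictors is controlled by their
truncated distance. -/
def SpreadErr {p : ℕ} (P : Measure (Obs p)) (B : ℝ) : Prop :=
  ∀ a b : Vec p → ℝ, Measurable a → Measurable b →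
    P.real {z | z.2 ∈ Set.uIcc (a z.1) (b z.1)} ≤ predDist P B a b

lemma leInd_nonneg (a b : ℝ) : 0 ≤ leInd a b := by unfold leInd; split_ifs <;> norm_num

lemma leInd_le_one (a b : ℝ) : leInd a b ≤ 1 := by unfold leInd; split_ifs <;> norm_num

section Measurability

variable {p : ℕ} {Ω Q : Type*} [MeasurableSpace Ω] [MeasurableSpace Q]

lemma Measurable.predErr' {G : Ω → Vec p → ℝ} (hG : Measurable (Function.uncurry G))
    {w : Q → Ω} (hw : Measurable w) {z : Q → Obs p} (hz : Measurable z) :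
    Measurable fun q => predErr (G (w q)) (z q) :=
  hz.snd.sub (hG.comp (hw.prodMk hz.fst))

lemma measurable_predErr {g : Vec p → ℝ} (hg : Measurable g) : Measurable (predErr g) :=
  measurable_snd.sub (hg.comp measurable_fst)

lemma Measurable.leInd' {a b : Q → ℝ} (ha : Measurable a) (hb : Measurable b) :
    Measurable fun q => leInd (a q) (b q) :=
  Measurable.ite (measurableSet_le ha hb) measurable_const measurable_const

lemma measurable_integral_param (P : Measure (Obs p)) [SFinite P] {φ : Q → Obs p → ℝ}
    (hφ : Measurable (Function.uncurry φ)) : Measurable fun q => ∫ z, φ q z ∂P :=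
  (hφ.stronglyMeasurable.integral_prod_right).measurable

lemma integrable_of_measurable_of_abs_le {μ : Measure Q} [IsFiniteMeasure μ] {φ : Q → ℝ}
    (hφ : Measurable φ) (C : ℝ) (hC : ∀ q, |φ q| ≤ C) : Integrable φ μ :=
  Integrable.of_bound hφ.aestronglyMeasurable C (ae_of_all _ hC)

lemma errCDF_eq_integral (P : Measure (Obs p)) [IsFiniteMeasure P] {g : Vec p → ℝ}
    (hg : Measurable g) (s : ℝ) : errCDF P g s = ∫ z, leInd (predErr g z) s ∂P := by
  have hm : MeasurableSet {z : Obs p | z.2 - g z.1 ≤ s} :=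
    measurableSet_le (measurable_predErr hg) measurable_const
  have : (fun z => leInd (predErr g z) s)
      = Set.indicator {z : Obs p | z.2 - g z.1 ≤ s} (fun _ => (1 : ℝ)) := by
    ext z; simp [leInd, predErr, Set.indicator]
  rw [this, integral_indicator hm]
  simp [errCDF, Measure.real]

lemma Measurable.errCDF' (P : Measure (Obs p)) [IsFiniteMeasure P] {G : Ω → Vec p → ℝ}
    (hG : Measurable (Function.uncurry G)) {w : Q → Ω} (hw : Measurable w) {s : Q → ℝ}
    (hs : Measurable s) : Measurable fun q => errCDF P (G (w q)) (s q) := by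
  have : (fun q => errCDF P (G (w q)) (s q))
      = fun q => ∫ z, leInd (predErr (G (w q)) z) (s q) ∂P := by
    ext q; exact errCDF_eq_integral P (hG.comp measurable_prodMk_left) _
  rw [this]
  exact measurable_integral_param P
    ((hG.predErr' (hw.comp measurable_fst) measurable_snd).leInd' (hs.comp measurable_fst))

lemma Measurable.predDist' (P : Measure (Obs p)) [IsFiniteMeasure P] (B : ℝ)
    {G H : Ω → Vec p → ℝ} (hG : Measurable (Function.uncurry G))
    (hH : Measurable (Function.uncurry H)) :
    Measurable fun ω => predDist P B (G ω) (H ω) := by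
  refine measurable_integral_param P ?_
  have h1 : Measurable fun q : Ω × Obs p => G q.1 q.2.1 :=
    hG.comp (measurable_fst.prodMk measurable_snd.fst)
  have h2 : Measurable fun q : Ω × Obs p => H q.1 q.2.1 :=
    hH.comp (measurable_fst.prodMk measurable_snd.fst)
  exact ((measurable_const.mul (h1.sub h2).norm)).min measurable_const

end Measurability

section Spread

variable {p : ℕ} {P : Measure (Obs p)} [IsProbabilityMeasure P] {B : ℝ}

omit [IsProbabilityMeasure P] in
lemma errCDF_nonneg (g : Vec p → ℝ) (s : ℝ) : 0 ≤ errCDF P g s := ENNReal.toReal_nonneg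

lemma errCDF_le_one (g : Vec p → ℝ) (s : ℝ) : errCDF P g s ≤ 1 := measureReal_le_one

lemma abs_min_one_le {x : ℝ} (hx : 0 ≤ x) : |min x 1| ≤ 1 := by
  rw [abs_of_nonneg (le_min hx zero_le_one)]; exact min_le_right _ _

lemma integrable_min_dist (hB : 0 ≤ B) {a b : Vec p → ℝ} (ha : Measurable a)
    (hb : Measurable b) : Integrable (fun z : Obs p => min (B * |a z.1 - b z.1|) 1) P :=
  integrable_of_measurable_of_abs_le
    (((measurable_const.mul ((ha.comp measurable_fst).sub (hb.comp measurable_fst)).norm)).min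
      measurable_const) 1 fun _ => abs_min_one_le (by positivity)

omit [IsProbabilityMeasure P] in
lemma predDist_nonneg (hB : 0 ≤ B) (a b : Vec p → ℝ) : 0 ≤ predDist P B a b :=
  integral_nonneg fun _ => le_min (by positivity) zero_le_one

omit [IsProbabilityMeasure P] in
lemma predDist_comm (a b : Vec p → ℝ) : predDist P B a b = predDist P B b a := by
  simp only [predDist, abs_sub_comm]

lemma predDist_le_one (hB : 0 ≤ B) (a b : Vec p → ℝ) : predDist P B a b ≤ 1 := by
  have := integral_mono_of_nonneg (μ := P) (f := fun z => min (B * |a z.1 - b z.1|) 1)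
    (g := fun _ => 1) (ae_of_all _ fun z => le_min (by positivity) zero_le_one)
    (integrable_const _) (ae_of_all _ fun z => min_le_right _ _)
  simpa [predDist] using this

lemma predDist_triangle (hB : 0 ≤ B) {a b c : Vec p → ℝ} (ha : Measurable a)
    (hb : Measurable b) (hc : Measurable c) :
    predDist P B a c ≤ predDist P B a b + predDist P B b c := by
  unfold predDist
  rw [← integral_add (integrable_min_dist hB ha hb) (integrable_min_dist hB hb hc)]
  refine integral_mono (integrable_min_dist hB ha hc)
    ((integrable_min_dist hB ha hb).add (integrable_min_dist hB hb hc)) fun z => ?_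
  have h := mul_le_mul_of_nonneg_left (abs_sub_le (a z.1) (b z.1) (c z.1)) hB
  have h1 : 0 ≤ B * |a z.1 - b z.1| := by positivity
  have h2 : 0 ≤ B * |b z.1 - c z.1| := by positivity
  dsimp only [Pi.add_apply]
  rcases le_total (B * |a z.1 - b z.1|) 1 with h3 | h3 <;>
  rcases le_total (B * |b z.1 - c z.1|) 1 with h4 | h4 <;>
  simp only [h3, h4, min_eq_left, min_eq_right] <;>
  first
    | exact (min_le_left _ _).trans (by linarith)
    | exact (min_le_right _ _).trans (by linarith)

lemma spreadErr_integral_le (hP : SpreadErr P B) {a b : Vec p → ℝ} (ha : Measurable a)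
    (hb : Measurable b) {φ : Obs p → ℝ} (h0 : ∀ z, 0 ≤ φ z) (h1 : ∀ z, φ z ≤ 1) (t : ℝ)
    (h : ∀ z : Obs p, z.2 ∉ Set.uIcc (a z.1 + t) (b z.1 + t) → φ z = 0) :
    ∫ z, φ z ∂P ≤ predDist P B a b := by
  have hm : MeasurableSet {z : Obs p | z.2 ∈ Set.uIcc (a z.1 + t) (b z.1 + t)} := by
    have h1 : Measurable fun z : Obs p => a z.1 + t := (ha.comp measurable_fst).add_const t
    have h2 : Measurable fun z : Obs p => b z.1 + t := (hb.comp measurable_fst).add_const t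
    exact (measurableSet_le (h1.min h2) measurable_snd).inter
      (measurableSet_le measurable_snd (h1.max h2))
  calc ∫ z, φ z ∂P
      ≤ ∫ z, Set.indicator {z : Obs p | z.2 ∈ Set.uIcc (a z.1 + t) (b z.1 + t)}
          (fun _ => (1 : ℝ)) z ∂P := by
        refine integral_mono_of_nonneg (ae_of_all _ h0)
          ((integrable_const _).indicator hm) (ae_of_all _ fun z => ?_)
        by_cases hz : z ∈ {z : Obs p | z.2 ∈ Set.uIcc (a z.1 + t) (b z.1 + t)}
        · simpa [Set.indicator_of_mem hz] using h1 z
        · simpa [Set.indicator_of_notMem hz] using (h z hz).le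
    _ = P.real {z : Obs p | z.2 ∈ Set.uIcc (a z.1 + t) (b z.1 + t)} := by
        rw [integral_indicator hm]; simp
    _ ≤ predDist P B (fun x => a x + t) (fun x => b x + t) :=
        hP _ _ (ha.add_const t) (hb.add_const t)
    _ = predDist P B a b := by simp [predDist]

lemma abs_leInd_sub_le_one (a b c d : ℝ) : |leInd a b - leInd c d| ≤ 1 := by
  rw [abs_le]
  constructor <;> linarith [leInd_nonneg a b, leInd_nonneg c d, leInd_le_one a b, leInd_le_one c d]

lemma integral_abs_leInd_left_le (hP : SpreadErr P B) {a b : Vec p → ℝ} (ha : Measurable a)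
    (hb : Measurable b) (t : ℝ) :
    ∫ z, |leInd (predErr a z) t - leInd (predErr b z) t| ∂P ≤ predDist P B a b := by
  refine spreadErr_integral_le hP ha hb (fun _ => abs_nonneg _)
    (fun _ => abs_leInd_sub_le_one _ _ _ _) t fun z hz => ?_
  rw [Set.mem_uIcc] at hz
  push Not at hz
  unfold leInd predErr
  split_ifs <;> grind

lemma integral_abs_leInd_right_le (hP : SpreadErr P B) {a b : Vec p → ℝ} (ha : Measurable a)
    (hb : Measurable b) (t : ℝ) :
    ∫ z, |leInd t (predErr a z) - leInd t (predErr b z)| ∂P ≤ predDist P B a b := by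
  refine spreadErr_integral_le hP ha hb (fun _ => abs_nonneg _)
    (fun _ => abs_leInd_sub_le_one _ _ _ _) t fun z hz => ?_
  rw [Set.mem_uIcc] at hz
  push Not at hz
  unfold leInd predErr
  split_ifs <;> grind

lemma integrable_leInd {a : Vec p → ℝ} (ha : Measurable a) (t : ℝ) :
    Integrable (fun z => leInd (predErr a z) t) P :=
  integrable_of_measurable_of_abs_le ((measurable_predErr ha).leInd' measurable_const) 1
    fun _ => by rw [abs_of_nonneg (leInd_nonneg _ _)]; exact leInd_le_one _ _

lemma abs_errCDF_sub_le (hP : SpreadErr P B) {a b : Vec p → ℝ} (ha : Measurable a)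
    (hb : Measurable b) (t : ℝ) : |errCDF P a t - errCDF P b t| ≤ predDist P B a b := by
  rw [errCDF_eq_integral P ha, errCDF_eq_integral P hb,
    ← integral_sub (integrable_leInd ha t) (integrable_leInd hb t)]
  exact abs_integral_le_integral_abs.trans (integral_abs_leInd_left_le hP ha hb t)

lemma abs_errCDF_sub_errCDF_le (hP : SpreadErr P B) {g : Vec p → ℝ}
    (hg : Measurable g) (s t : ℝ) :
    |errCDF P g s - errCDF P g t| ≤ min (B * |s - t|) 1 := by
  have h := abs_errCDF_sub_le hP (hg.add_const s) (hg.add_const t) 0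
  have e : ∀ r, errCDF P (fun x => g x + r) 0 = errCDF P g r := fun r => by
    unfold errCDF; congr 2; ext z; constructor <;> intro h <;> simp only [Set.mem_ofPred_eq] at * <;>
      linarith
  rw [e, e] at h
  simpa [predDist] using h

lemma errCDF_mono (g : Vec p → ℝ) : Monotone (errCDF P g) := fun _ _ hst =>
  measureReal_mono fun _ hz => le_trans hz hst

lemma continuous_errCDF (hB : 0 ≤ B) (hP : SpreadErr P B) {g : Vec p → ℝ} (hg : Measurable g) :
    Continuous (errCDF P g) :=
  (LipschitzWith.of_dist_le_mul (K := ⟨B, hB⟩) fun s t =>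
    (abs_errCDF_sub_errCDF_le hP hg s t).trans (min_le_left _ _)).continuous

lemma integral_abs_errCDF_predErr_le (hB : 0 ≤ B) (hP : SpreadErr P B) {g h : Vec p → ℝ}
    (hg : Measurable g) (hh : Measurable h) :
    ∫ z, |errCDF P g (predErr g z) - errCDF P h (predErr h z)| ∂P ≤ 2 * predDist P B g h := by
  calc _ ≤ ∫ z, (min (B * |g z.1 - h z.1|) 1 + predDist P B g h) ∂P := by
        refine integral_mono_of_nonneg (ae_of_all _ fun _ => abs_nonneg _)
          ((integrable_min_dist hB hg hh).add (integrable_const _)) (ae_of_all _ fun z => ?_)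
        have h1 := abs_errCDF_sub_errCDF_le hP hg (predErr g z) (predErr h z)
        have h2 := abs_errCDF_sub_le hP hg hh (predErr h z)
        have e : |predErr g z - predErr h z| = |g z.1 - h z.1| := by
          rw [abs_sub_comm]; unfold predErr; congr 1; ring
        rw [e] at h1
        exact (abs_sub_le _ (errCDF P g (predErr h z)) _).trans (add_le_add h1 h2)
    _ = 2 * predDist P B g h := by
        rw [integral_add (integrable_min_dist hB hg hh) (integrable_const _)]
        simp [predDist]; ring

/-- Under (C1) the response falls between two predictors with probability at most their
truncated distance at scale `1 / ‖f‖_∞`. -/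
lemma IsC1.spreadErr {m : Vec p → ℝ} {f : ℝ → ℝ} (h : IsC1 P m f) :
    SpreadErr P (⨆ s, f s) := by
  obtain ⟨hm, hf0, hfb, hind, hlaw, -, -⟩ := h
  intro a b ha hb
  have hB : 0 ≤ ⨆ s, f s := Real.iSup_nonneg hf0
  have hu : Measurable fun z : Obs p => z.2 - m z.1 := measurable_predErr hm
  have hprod := (indepFun_iff_map_prod_eq_prod_map_map measurable_fst.aemeasurable
    hu.aemeasurable).1 hind
  have : IsProbabilityMeasure (P.map fun z : Obs p => z.1) :=
    Measure.isProbabilityMeasure_map measurable_fst.aemeasurable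
  have hPu : IsProbabilityMeasure (P.map fun z : Obs p => z.2 - m z.1) :=
    Measure.isProbabilityMeasure_map hu.aemeasurable
  set S : Set (Vec p × ℝ) := {q | q.2 ∈ Set.uIcc (a q.1 - m q.1) (b q.1 - m q.1)} with hS
  have hSm : MeasurableSet S := by
    have h1 : Measurable fun q : Vec p × ℝ => a q.1 - m q.1 := (ha.sub hm).comp measurable_fst
    have h2 : Measurable fun q : Vec p × ℝ => b q.1 - m q.1 := (hb.sub hm).comp measurable_fst
    exact (measurableSet_le (h1.min h2) measurable_snd).inter
      (measurableSet_le measurable_snd (h1.max h2))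
  have hset : {z : Obs p | z.2 ∈ Set.uIcc (a z.1) (b z.1)}
      = (fun z : Obs p => (z.1, z.2 - m z.1)) ⁻¹' S := by
    ext z
    simp only [hS, Set.mem_ofPred_eq, Set.mem_preimage, Set.mem_uIcc, sub_le_sub_iff_right]
  have hIcc : ∀ c d : ℝ, (P.map fun z : Obs p => z.2 - m z.1) (Set.uIcc c d)
      ≤ ENNReal.ofReal (min ((⨆ s, f s) * |c - d|) 1) := by
    intro c d
    rw [ENNReal.ofReal_min, ENNReal.ofReal_one]
    refine le_min ?_ prob_le_one
    rw [hlaw, withDensity_apply _ measurableSet_uIcc]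
    calc _ ≤ ∫⁻ _ in Set.uIcc c d, ENNReal.ofReal (⨆ s, f s) :=
          lintegral_mono fun s => ENNReal.ofReal_le_ofReal (le_ciSup hfb s)
      _ = _ := by
          rw [lintegral_const, Measure.restrict_apply_univ, Real.volume_interval,
            ENNReal.ofReal_mul hB, abs_sub_comm]
  have key : P {z : Obs p | z.2 ∈ Set.uIcc (a z.1) (b z.1)}
      ≤ ENNReal.ofReal (predDist P (⨆ s, f s) a b) := by
    rw [hset, ← Measure.map_apply (measurable_fst.prodMk hu) hSm, hprod,
      Measure.prod_apply hSm]
    unfold predDist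
    rw [ofReal_integral_eq_lintegral_ofReal (integrable_min_dist hB ha hb)
      (ae_of_all _ fun z => le_min (by positivity) zero_le_one)]
    have hmeas : Measurable fun x : Vec p =>
        ENNReal.ofReal (min ((⨆ s, f s) * |a x - b x|) 1) :=
      ((measurable_const.mul (ha.sub hb).norm).min measurable_const).ennreal_ofReal
    rw [← lintegral_map (f := fun x : Vec p =>
      ENNReal.ofReal (min ((⨆ s, f s) * |a x - b x|) 1)) hmeas measurable_fst]
    refine lintegral_mono fun x => ?_
    have := hIcc (a x - m x) (b x - m x)
    rwa [sub_sub_sub_cancel_right] at this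
  exact ENNReal.toReal_le_of_le_ofReal (predDist_nonneg hB a b) key

end Spread
section Deterministic

variable {p : ℕ} {P : Measure (Obs p)} [IsProbabilityMeasure P] {B : ℝ}

lemma empCDF_mono {n : ℕ} (u : Fin n → ℝ) : Monotone (empCDF u) := fun s t hst => by
  unfold empCDF
  gcongr

lemma empCDF_nonneg {n : ℕ} (u : Fin n → ℝ) (s : ℝ) : 0 ≤ empCDF u s := by
  unfold empCDF; positivity

lemma empCDF_le_one {n : ℕ} (u : Fin n → ℝ) (s : ℝ) : empCDF u s ≤ 1 := by
  unfold empCDF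
  refine div_le_one_of_le₀ ?_ (by positivity)
  exact_mod_cast (Finset.card_le_univ _).trans (Fintype.card_fin n).le

lemma abs_empCDF_sub_errCDF_le_one {n : ℕ} (u : Fin n → ℝ) (g : Vec p → ℝ) (s t : ℝ) :
    |empCDF u s - errCDF P g t| ≤ 1 := by
  rw [abs_le]
  constructor <;>
  linarith [empCDF_nonneg u s, empCDF_le_one u s, errCDF_nonneg (P := P) g t,
    errCDF_le_one (P := P) g t]

lemma errCDF_eq_cdf {g : Vec p → ℝ} (hg : Measurable g) :
    errCDF P g = cdf (P.map (predErr g)) := by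
  have := Measure.isProbabilityMeasure_map (μ := P) (measurable_predErr hg).aemeasurable
  ext s
  rw [cdf_eq_real, map_measureReal_apply (measurable_predErr hg) measurableSet_Iic]
  rfl

lemma tendsto_errCDF_atTop {g : Vec p → ℝ} (hg : Measurable g) :
    Tendsto (errCDF P g) atTop (𝓝 1) := by
  rw [errCDF_eq_cdf hg]; exact tendsto_cdf_atTop _

lemma tendsto_errCDF_atBot {g : Vec p → ℝ} (hg : Measurable g) :
    Tendsto (errCDF P g) atBot (𝓝 0) := by
  rw [errCDF_eq_cdf hg]; exact tendsto_cdf_atBot _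

lemma measureReal_Ioc_predErr {g : Vec p → ℝ} (hg : Measurable g) {s t : ℝ} (hst : s ≤ t) :
    P.real {z | predErr g z ∈ Set.Ioc s t} = errCDF P g t - errCDF P g s := by
  have h1 : {z | predErr g z ∈ Set.Ioc s t}
      = {z : Obs p | z.2 - g z.1 ≤ t} \ {z : Obs p | z.2 - g z.1 ≤ s} := by
    ext z; simp [predErr, and_comm, lt_sub_iff_add_lt]
  have h2 : {z : Obs p | z.2 - g z.1 ≤ s} ⊆ {z : Obs p | z.2 - g z.1 ≤ t} :=
    fun z hz => le_trans hz hst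
  rw [h1, measureReal_sdiff h2 (measurableSet_le (measurable_predErr hg) measurable_const)]
  rfl

/-- If the distribution function of the prediction error is at sup-distance more than `2 * ε`
from a monotone function, then the mean squared deviation of the two under the law of the
prediction error is at least `ε ^ 3`. -/
lemma pow_three_le_integral_sq (hB : 0 ≤ B) (hP : SpreadErr P B) {g : Vec p → ℝ}
    (hg : Measurable g) {n : ℕ} (u : Fin n → ℝ) {ε : ℝ} (hε : 0 < ε) (s : ℝ)
    (h : 2 * ε < |empCDF u s - errCDF P g s|) :
    ε ^ 3 ≤ ∫ z, (empCDF u (predErr g z) - errCDF P g (predErr g z)) ^ 2 ∂P := by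
  have hcont := continuous_errCDF hB hP hg
  have hmeas : Measurable fun z =>
      (empCDF u (predErr g z) - errCDF P g (predErr g z)) ^ 2 :=
    (((empCDF_mono u).measurable.comp (measurable_predErr hg)).sub
      (hcont.measurable.comp (measurable_predErr hg))).pow_const 2
  have hint : Integrable (fun z =>
      (empCDF u (predErr g z) - errCDF P g (predErr g z)) ^ 2) P :=
    integrable_of_measurable_of_abs_le hmeas 1 fun z => by
      rw [abs_pow]
      exact pow_le_one₀ (abs_nonneg _) (abs_empCDF_sub_errCDF_le_one _ _ _ _)
  obtain ⟨a, b, hab, hmass, hdev⟩ : ∃ a b, a ≤ b ∧ errCDF P g b - errCDF P g a = ε ∧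
      ∀ t ∈ Set.Ioc a b, ε ^ 2 ≤ (empCDF u t - errCDF P g t) ^ 2 := by
    rcases lt_abs.1 h with h | h
    · have h1 : errCDF P g s + ε < 1 := by linarith [empCDF_le_one u s]
      obtain ⟨b, hb, hsb⟩ := ((tendsto_errCDF_atTop (P := P) hg).eventually
        (lt_mem_nhds h1) |>.and (eventually_ge_atTop s)).exists
      obtain ⟨c, hc, hc'⟩ := intermediate_value_Icc hsb hcont.continuousOn
        (show errCDF P g s + ε ∈ Set.Icc _ _ from ⟨by linarith, hb.le⟩)
      refine ⟨s, c, hc.1, by linarith, fun t ht => ?_⟩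
      have h2 := empCDF_mono u ht.1.le
      have h3 := errCDF_mono (P := P) g ht.2
      nlinarith
    · have h1 : 0 < errCDF P g s - ε := by linarith [empCDF_nonneg u s]
      obtain ⟨b, hb, hsb⟩ := ((tendsto_errCDF_atBot (P := P) hg).eventually
        (gt_mem_nhds h1) |>.and (eventually_le_atBot s)).exists
      obtain ⟨c, hc, hc'⟩ := intermediate_value_Icc hsb hcont.continuousOn
        (show errCDF P g s - ε ∈ Set.Icc _ _ from ⟨hb.le, by linarith⟩)
      refine ⟨c, s, hc.2, by linarith, fun t ht => ?_⟩
      have h2 := empCDF_mono u ht.2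
      have h3 := errCDF_mono (P := P) g ht.1.le
      nlinarith
  have hm : MeasurableSet {z | predErr g z ∈ Set.Ioc a b} :=
    measurable_predErr hg measurableSet_Ioc
  calc ε ^ 3 = ∫ z, Set.indicator {z | predErr g z ∈ Set.Ioc a b} (fun _ => ε ^ 2) z ∂P := by
        rw [integral_indicator hm]
        simp only [integral_const, measureReal_restrict_apply_univ, smul_eq_mul]
        rw [measureReal_Ioc_predErr hg hab, hmass]; ring
    _ ≤ _ := by
        refine integral_mono ((integrable_const _).indicator hm) hint fun z => ?_
        by_cases hz : z ∈ {z | predErr g z ∈ Set.Ioc a b}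
        · rw [Set.indicator_of_mem hz]; exact hdev _ hz
        · rw [Set.indicator_of_notMem hz]; positivity

lemma iSup_abs_empCDF_sub_errCDF_le (hB : 0 ≤ B) (hP : SpreadErr P B) {g : Vec p → ℝ}
    (hg : Measurable g) {n : ℕ} (u : Fin n → ℝ) {ε : ℝ} (hε : 0 < ε) :
    ⨆ s, |empCDF u s - errCDF P g s| ≤ 2 * ε +
      (∫ z, (empCDF u (predErr g z) - errCDF P g (predErr g z)) ^ 2 ∂P) / ε ^ 3 := by
  refine ciSup_le fun s => ?_
  have h0 : 0 ≤ (∫ z, (empCDF u (predErr g z) - errCDF P g (predErr g z)) ^ 2 ∂P) / ε ^ 3 :=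
    div_nonneg (integral_nonneg fun _ => sq_nonneg _) (by positivity)
  rcases le_or_gt |empCDF u s - errCDF P g s| (2 * ε) with h | h
  · linarith
  · have h1 : 1 ≤ (∫ z, (empCDF u (predErr g z) - errCDF P g (predErr g z)) ^ 2 ∂P) / ε ^ 3 :=
      (one_le_div (by positivity)).2 (pow_three_le_integral_sq hB hP hg u hε s h)
    linarith [abs_empCDF_sub_errCDF_le_one (P := P) u g s s]

lemma bddAbove_abs_empCDF_sub_errCDF {n : ℕ} (u : Fin n → ℝ) (g : Vec p → ℝ) :
    BddAbove (Set.range fun s => |empCDF u s - errCDF P g s|) :=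
  ⟨1, by rintro _ ⟨s, rfl⟩; exact abs_empCDF_sub_errCDF_le_one u g s s⟩

lemma orderStat_mono {n : ℕ} (u : Fin n → ℝ) : Monotone (orderStat u) := fun k l hkl => by
  unfold orderStat
  split_ifs with h
  · exact le_rfl
  · exact Tuple.monotone_sort u (by simp only [Fin.mk_le_mk]; omega)

lemma le_empCDF_orderStat {n : ℕ} (u : Fin n → ℝ) {k : ℕ} (hk : k < n) :
    ((k + 1 : ℕ) : ℝ) / n ≤ empCDF u (orderStat u k) := by
  unfold empCDF
  gcongr
  have hsub : (Finset.univ.filter fun j : Fin n => (j : ℕ) ≤ k).image (Tuple.sort u)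
      ⊆ Finset.univ.filter fun i : Fin n => u i ≤ orderStat u k := by
    intro i hi
    obtain ⟨j, hj, rfl⟩ := Finset.mem_image.1 hi
    have hj' : (j : ℕ) ≤ k := (Finset.mem_filter.1 hj).2
    refine Finset.mem_filter.2 ⟨Finset.mem_univ _, ?_⟩
    rw [orderStat, dif_neg (by omega)]
    exact Tuple.monotone_sort u (by rw [Fin.le_def]; simp only; omega)
  refine le_trans ?_ (Finset.card_le_card hsub)
  rw [Finset.card_image_of_injective _ (Tuple.sort u).injective]
  have : (Finset.univ.filter fun j : Fin n => (j : ℕ) ≤ k) = Finset.Iic (⟨k, hk⟩ : Fin n) := by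
    ext j; simp [Fin.le_def]
  rw [this, Fin.card_Iic]

lemma empCDF_le_of_lt_orderStat {n : ℕ} (u : Fin n → ℝ) {k : ℕ} (hk : k < n) {t : ℝ}
    (ht : t < orderStat u k) : empCDF u t ≤ (k : ℝ) / n := by
  unfold empCDF
  gcongr
  have hsub : (Finset.univ.filter fun i : Fin n => u i ≤ t)
      ⊆ (Finset.Iio (⟨k, hk⟩ : Fin n)).image (Tuple.sort u) := by
    intro i hi
    have hi' : u i ≤ t := (Finset.mem_filter.1 hi).2
    refine Finset.mem_image.2 ⟨(Tuple.sort u).symm i, ?_, by simp⟩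
    rw [Finset.mem_Iio]
    by_contra hcon
    have h1 := Tuple.monotone_sort u (not_lt.1 hcon)
    rw [orderStat, dif_neg (by omega)] at ht
    have h2 : (⟨min k (n - 1), by omega⟩ : Fin n) = ⟨k, hk⟩ := by
      ext; simp only; omega
    rw [h2] at ht
    simp only [Function.comp_apply, Equiv.apply_symm_apply] at h1 ht
    linarith
  refine (Finset.card_le_card hsub).trans ?_
  rw [Finset.card_image_of_injective _ (Tuple.sort u).injective, Fin.card_Iio]

/-- The distribution function of the prediction error, evaluated at an empirical `α`-quantile,
differs from `α` by at most its sup-distance to the empirical distribution function. -/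
lemma abs_errCDF_qhat_sub_le (hB : 0 ≤ B) (hP : SpreadErr P B) {g : Vec p → ℝ}
    (hg : Measurable g) {n : ℕ} (hn : 0 < n) (u : Fin n → ℝ) {α : ℝ} (h0 : 0 ≤ α)
    (h1 : α ≤ 1) :
    |errCDF P g (qhat u α) - α| ≤ ⨆ s, |empCDF u s - errCDF P g s| := by
  set D := ⨆ s, |empCDF u s - errCDF P g s| with hD
  have hle : ∀ s, |empCDF u s - errCDF P g s| ≤ D :=
    le_ciSup (bddAbove_abs_empCDF_sub_errCDF u g)
  have hn' : (0 : ℝ) < n := by exact_mod_cast hn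
  unfold qhat
  split_ifs with hα
  · have h2 := hle (orderStat u 0 - Real.exp (-(n : ℝ)))
    have h3 : empCDF u (orderStat u 0 - Real.exp (-(n : ℝ))) ≤ 0 := by
      have := empCDF_le_of_lt_orderStat u hn
        (sub_lt_self (orderStat u 0) (Real.exp_pos (-(n : ℝ))))
      simpa using this
    rw [le_antisymm h3 (empCDF_nonneg _ _), abs_sub_comm] at h2
    rwa [hα]
  · have hα' : 0 < α := lt_of_le_of_ne h0 (Ne.symm hα)
    have hpos : 0 < ⌈(n : ℝ) * α⌉₊ := Nat.ceil_pos.2 (by positivity)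
    have hle_n : ⌈(n : ℝ) * α⌉₊ ≤ n := Nat.ceil_le.2 (by nlinarith)
    obtain ⟨k, hk⟩ : ∃ k, ⌈(n : ℝ) * α⌉₊ = k + 1 := ⟨_, (Nat.succ_pred_eq_of_pos hpos).symm⟩
    have hkn : k < n := by omega
    rw [hk, Nat.add_sub_cancel]
    have hk1 : (n : ℝ) * α ≤ (k + 1 : ℕ) := hk ▸ Nat.le_ceil _
    have hk2 : (k : ℝ) < n * α := Nat.lt_ceil.1 (by omega)
    rw [abs_le]
    constructor
    · have h2 := le_empCDF_orderStat u hkn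
      have h3 := (abs_le.1 (hle (orderStat u k))).2
      have h4 : α ≤ ((k + 1 : ℕ) : ℝ) / n := (le_div_iff₀ hn').2 (by linarith)
      linarith
    · have h2 : ∀ t < orderStat u k, errCDF P g t ≤ α + D := fun t ht => by
        have h3 := empCDF_le_of_lt_orderStat u hkn ht
        have h4 := (abs_le.1 (hle t)).1
        have h5 : (k : ℝ) / n ≤ α := (div_le_iff₀ hn').2 (by linarith)
        linarith
      have h3 : errCDF P g (orderStat u k) ≤ α + D :=
        le_of_tendsto ((continuous_errCDF hB hP hg).continuousWithinAt
          (s := Set.Iio (orderStat u k)) (x := orderStat u k)).tendsto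
          (eventually_nhdsWithin_of_forall h2)
      linarith

lemma qhat_mono {n : ℕ} (u : Fin n → ℝ) {α β : ℝ} (h0 : 0 ≤ α) (hαβ : α ≤ β) :
    qhat u α ≤ qhat u β := by
  unfold qhat
  split_ifs with h1 h2 h2
  · exact le_rfl
  · exact (sub_le_self _ (Real.exp_pos _).le).trans (orderStat_mono u (Nat.zero_le _))
  · exact absurd (le_antisymm (h2 ▸ hαβ) h0) h1
  · exact orderStat_mono u (Nat.sub_le_sub_right (Nat.ceil_mono (by gcongr)) 1)

lemma abs_coverProb_qhat_sub_le (hB : 0 ≤ B) (hP : SpreadErr P B) {g : Vec p → ℝ}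
    (hg : Measurable g) {n : ℕ} (hn : 0 < n) (u : Fin n → ℝ) {α β : ℝ} (h0 : 0 ≤ α)
    (hαβ : α ≤ β) (h1 : β ≤ 1) :
    |coverProb P g (qhat u α) (qhat u β) - (β - α)|
      ≤ 2 * ⨆ s, |empCDF u s - errCDF P g s| := by
  have hc : coverProb P g (qhat u α) (qhat u β)
      = errCDF P g (qhat u β) - errCDF P g (qhat u α) := by
    rw [← measureReal_Ioc_predErr hg (qhat_mono u h0 hαβ)]
    unfold coverProb Measure.real
    congr 2
    ext z
    simp only [predErr, Set.mem_ofPred_eq, Set.mem_Ioc, lt_sub_iff_add_lt, sub_le_iff_le_add,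
      add_comm]
  have h2 := abs_errCDF_qhat_sub_le hB hP hg hn u h0 (hαβ.trans h1)
  have h3 := abs_errCDF_qhat_sub_le hB hP hg hn u (h0.trans hαβ) h1
  rw [hc, abs_le]
  rw [abs_le] at h2 h3
  constructor <;> linarith

end Deterministic
section Resampling

variable {Z : Type*} [MeasurableSpace Z] {P : Measure Z} [IsProbabilityMeasure P]

/-- Selecting distinct coordinates of an i.i.d. sample yields an i.i.d. sample. -/
lemma measurePreserving_pi_comp {κ κ' : Type*} [Fintype κ] [Fintype κ'] {e : κ → κ'}
    (he : Function.Injective e) :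
    MeasurePreserving (fun ω : κ' → Z => ω ∘ e) (Measure.pi fun _ : κ' => P)
      (Measure.pi fun _ : κ => P) := by
  have hm : Measurable fun ω : κ' → Z => ω ∘ e :=
    measurable_pi_lambda _ fun k => measurable_pi_apply (e k)
  refine ⟨hm, (Measure.pi_eq fun s hs => ?_).symm⟩
  rw [Measure.map_apply hm (MeasurableSet.univ_pi hs)]
  have : (fun ω : κ' → Z => ω ∘ e) ⁻¹' (Set.univ.pi s)
      = Set.univ.pi (Function.extend e s fun _ => Set.univ) := by
    ext ω
    simp only [Set.mem_preimage, Set.mem_univ_pi, Function.comp_apply]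
    constructor
    · intro h j
      by_cases hj : ∃ k, e k = j
      · obtain ⟨k, rfl⟩ := hj
        rw [he.extend_apply]; exact h k
      · rw [Function.extend_apply' _ _ _ hj]; trivial
    · intro h k
      have := h (e k)
      rwa [he.extend_apply] at this
  rw [this, Measure.pi_pi]
  refine (Fintype.prod_of_injective e he _ _ (fun j hj => ?_) fun k => ?_).symm
  · rw [Function.extend_apply' _ _ _ (by simpa using hj)]; exact measure_univ
  · rw [he.extend_apply]

/-- Replacing one coordinate of an i.i.d. sample by an independent copy preserves the law. -/
lemma measurePreserving_pi_update {κ : Type*} [Fintype κ] [DecidableEq κ] (k : κ) :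
    MeasurePreserving (fun q : (κ → Z) × Z => Function.update q.1 k q.2)
      ((Measure.pi fun _ : κ => P).prod P) (Measure.pi fun _ : κ => P) := by
  have hm : Measurable fun q : (κ → Z) × Z => Function.update q.1 k q.2 := by
    refine measurable_pi_lambda _ fun j => ?_
    by_cases hj : j = k
    · subst hj; simpa using measurable_snd
    · simp only [Function.update_of_ne hj]
      exact (measurable_pi_apply j).comp measurable_fst
  refine ⟨hm, (Measure.pi_eq fun s hs => ?_).symm⟩
  rw [Measure.map_apply hm (MeasurableSet.univ_pi hs)]
  have : (fun q : (κ → Z) × Z => Function.update q.1 k q.2) ⁻¹' (Set.univ.pi s)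
      = (Set.univ.pi (Function.update s k Set.univ)) ×ˢ s k := by
    ext q
    simp only [Set.mem_preimage, Set.mem_univ_pi, Set.mem_prod]
    constructor
    · intro h
      refine ⟨fun j => ?_, by simpa using h k⟩
      by_cases hj : j = k
      · subst hj; simp
      · simpa [Function.update_of_ne hj] using h j
    · rintro ⟨h, hk⟩ j
      by_cases hj : j = k
      · subst hj; simpa using hk
      · simpa [Function.update_of_ne hj] using h j
  rw [this, Measure.prod_prod, Measure.pi_pi, ← Finset.mul_prod_erase _ _ (Finset.mem_univ k),
    ← Finset.mul_prod_erase (a := k) _ (fun i => P (s i)) (Finset.mem_univ k),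
    Function.update_self, measure_univ, one_mul, mul_comm]
  congr 1
  refine Finset.prod_congr rfl fun j hj => ?_
  rw [Function.update_of_ne (Finset.ne_of_mem_erase hj)]

/-- A coordinate of an i.i.d. sample may be integrated out first if the remaining dependence
on the sample does not involve that coordinate. -/
lemma integral_pi_resample {κ : Type*} [Fintype κ] [DecidableEq κ] (k : κ)
    {Φ : (κ → Z) → Z → ℝ} (hΦ : Measurable (Function.uncurry Φ)) (C : ℝ)
    (hC : ∀ ω z, |Φ ω z| ≤ C) (hinv : ∀ ω y, Φ (Function.update ω k y) = Φ ω) :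
    ∫ ω, Φ ω (ω k) ∂(Measure.pi fun _ : κ => P)
      = ∫ ω, ∫ z, Φ ω z ∂P ∂(Measure.pi fun _ : κ => P) := by
  have hmp := measurePreserving_pi_update (P := P) k
  have hm : Measurable fun ω : κ → Z => Φ ω (ω k) :=
    hΦ.comp (measurable_id.prodMk (measurable_pi_apply k))
  rw [← hmp.map_eq, integral_map hmp.measurable.aemeasurable hm.aestronglyMeasurable,
    hmp.map_eq]
  simp only [hinv, Function.update_self]
  exact integral_prod (Function.uncurry Φ)
    (integrable_of_measurable_of_abs_le hΦ C fun q => hC q.1 q.2)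

end Resampling

section Pair

variable {p : ℕ} {P : Measure (Obs p)} [IsProbabilityMeasure P] {B : ℝ}
  {κ : Type*} [Fintype κ] [DecidableEq κ]

lemma abs_abs_leInd_sub_le_one (a b c d : ℝ) : |(|leInd a b - leInd c d|)| ≤ 1 := by
  rw [abs_abs]; exact abs_leInd_sub_le_one _ _ _ _

lemma abs_integral_le_one {φ : Obs p → ℝ} (h : ∀ z, |φ z| ≤ 1) : |∫ z, φ z ∂P| ≤ 1 := by
  have := norm_integral_le_of_norm_le_const (μ := P) (f := φ) (C := 1) (ae_of_all _ h)
  simpa using this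

lemma integrable_predDist {Ω : Type*} [MeasurableSpace Ω] {μ : Measure Ω} [IsFiniteMeasure μ]
    (hB : 0 ≤ B) {G H : Ω → Vec p → ℝ} (hG : Measurable (Function.uncurry G))
    (hH : Measurable (Function.uncurry H)) :
    Integrable (fun ω => predDist P B (G ω) (H ω)) μ :=
  integrable_of_measurable_of_abs_le (Measurable.predDist' P B hG hH) 1 fun ω => by
    rw [abs_of_nonneg (predDist_nonneg hB _ _)]; exact predDist_le_one hB _ _

lemma Measurable.predictor {Ω Q : Type*} [MeasurableSpace Ω] [MeasurableSpace Q]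
    {G : Ω → Vec p → ℝ} (hG : Measurable (Function.uncurry G)) {w : Q → Ω} (hw : Measurable w) :
    Measurable (Function.uncurry fun q => G (w q)) :=
  hG.comp ((hw.comp measurable_fst).prodMk measurable_snd)

lemma integral_abs_leInd_sub_le (hB : 0 ≤ B) (hP : SpreadErr P B)
    {G Gi H : (κ → Obs p) → Vec p → ℝ} (hG : Measurable (Function.uncurry G))
    (hGi : Measurable (Function.uncurry Gi)) (hH : Measurable (Function.uncurry H)) (i : κ)
    (hGi_inv : ∀ ω y, Gi (Function.update ω i y) = Gi ω)
    (hH_inv : ∀ ω y, H (Function.update ω i y) = H ω) :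
    ∫ ω, ∫ z, |leInd (predErr (Gi ω) (ω i)) (predErr (G ω) z)
        - leInd (predErr (H ω) (ω i)) (predErr (H ω) z)| ∂P ∂(Measure.pi fun _ : κ => P)
      ≤ ∫ ω, predDist P B (G ω) (Gi ω) ∂(Measure.pi fun _ : κ => P)
        + 2 * ∫ ω, predDist P B (Gi ω) (H ω) ∂(Measure.pi fun _ : κ => P) := by
  set μ := Measure.pi fun _ : κ => P with hμ
  let Ψ : (κ → Obs p) → Obs p → ℝ := fun ω y =>
    ∫ z, |leInd (predErr (Gi ω) y) (predErr (Gi ω) z)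
      - leInd (predErr (H ω) y) (predErr (Gi ω) z)| ∂P
  have hGm : ∀ ω, Measurable (G ω) := fun ω => hG.comp measurable_prodMk_left
  have hGim : ∀ ω, Measurable (Gi ω) := fun ω => hGi.comp measurable_prodMk_left
  have hHm : ∀ ω, Measurable (H ω) := fun ω => hH.comp measurable_prodMk_left
  have hΨ' : ∀ ω, Measurable (Function.uncurry fun y z =>
      |leInd (predErr (Gi ω) y) (predErr (Gi ω) z)
      - leInd (predErr (H ω) y) (predErr (Gi ω) z)|) := fun ω => by
    have h1 := (measurable_predErr (hGim ω))
    have h2 := (measurable_predErr (hHm ω))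
    exact (((h1.comp measurable_fst).leInd' (h1.comp measurable_snd)).sub
      ((h2.comp measurable_fst).leInd' (h1.comp measurable_snd))).norm
  have hΨm : Measurable (Function.uncurry Ψ) := by
    refine measurable_integral_param P ?_
    have h1 : Measurable fun q : ((κ → Obs p) × Obs p) × Obs p => predErr (Gi q.1.1) q.1.2 :=
      hGi.predErr' measurable_fst.fst measurable_fst.snd
    have h2 : Measurable fun q : ((κ → Obs p) × Obs p) × Obs p => predErr (Gi q.1.1) q.2 :=
      hGi.predErr' measurable_fst.fst measurable_snd
    have h3 : Measurable fun q : ((κ → Obs p) × Obs p) × Obs p => predErr (H q.1.1) q.1.2 :=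
      hH.predErr' measurable_fst.fst measurable_fst.snd
    exact ((h1.leInd' h2).sub (h3.leInd' h2)).norm
  have hΨ1 : ∀ ω y, |Ψ ω y| ≤ 1 := fun ω y =>
    abs_integral_le_one fun z => abs_abs_leInd_sub_le_one _ _ _ _
  have hΨinv : ∀ ω y, Ψ (Function.update ω i y) = Ψ ω := fun ω y => by
    ext; simp only [Ψ, hGi_inv, hH_inv]
  have hΨi : Integrable (fun ω => Ψ ω (ω i)) μ :=
    integrable_of_measurable_of_abs_le
      (hΨm.comp (measurable_id.prodMk (measurable_pi_apply i))) 1 fun ω => hΨ1 _ _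
  have hmid : ∫ ω, Ψ ω (ω i) ∂μ ≤ ∫ ω, predDist P B (Gi ω) (H ω) ∂μ := by
    rw [integral_pi_resample i hΨm 1 hΨ1 hΨinv]
    refine integral_mono_of_nonneg (ae_of_all _ fun ω => integral_nonneg fun y =>
      integral_nonneg fun z => abs_nonneg _) (integrable_predDist hB hGi hH)
      (ae_of_all _ fun ω => ?_)
    simp only [Ψ]
    rw [integral_integral_swap (integrable_of_measurable_of_abs_le (hΨ' ω) 1
      fun q => abs_abs_leInd_sub_le_one _ _ _ _)]
    refine (integral_mono_of_nonneg (ae_of_all _ fun z => integral_nonneg fun y => abs_nonneg _)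
      (integrable_const (predDist P B (Gi ω) (H ω))) (ae_of_all _ fun z =>
        integral_abs_leInd_left_le hP (hGim ω) (hHm ω) _)).trans ?_
    simp
  have hpt : ∀ ω, ∫ z, |leInd (predErr (Gi ω) (ω i)) (predErr (G ω) z)
        - leInd (predErr (H ω) (ω i)) (predErr (H ω) z)| ∂P
      ≤ predDist P B (G ω) (Gi ω) + Ψ ω (ω i) + predDist P B (Gi ω) (H ω) := by
    intro ω
    have hi : ∀ {a b : Vec p → ℝ} (s t : ℝ), Measurable a → Measurable b → Integrable
        (fun z => |leInd s (predErr a z) - leInd t (predErr b z)|) P := fun s t ha hb =>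
      integrable_of_measurable_of_abs_le
        ((measurable_const.leInd' (measurable_predErr ha)).sub
          (measurable_const.leInd' (measurable_predErr hb))).norm 1
        fun z => abs_abs_leInd_sub_le_one _ _ _ _
    have h1 := integral_abs_leInd_right_le hP (hGm ω) (hGim ω) (predErr (Gi ω) (ω i))
    have h2 := integral_abs_leInd_right_le hP (hGim ω) (hHm ω) (predErr (H ω) (ω i))
    refine le_trans ?_ (add_le_add (add_le_add_left h1 _) h2)
    simp only [Ψ]
    have j1 := hi (predErr (Gi ω) (ω i)) (predErr (Gi ω) (ω i)) (hGm ω) (hGim ω)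
    have j2 := hi (predErr (Gi ω) (ω i)) (predErr (H ω) (ω i)) (hGim ω) (hGim ω)
    have j3 := hi (predErr (H ω) (ω i)) (predErr (H ω) (ω i)) (hGim ω) (hHm ω)
    rw [← integral_add' j1 j2, ← integral_add' (j1.add j2) j3]
    refine integral_mono (hi _ _ (hGm ω) (hHm ω)) ((j1.add j2).add j3) fun z => ?_
    exact (abs_sub_le _ (leInd (predErr (H ω) (ω i)) (predErr (Gi ω) z)) _).trans
      (add_le_add_left (abs_sub_le _ (leInd (predErr (Gi ω) (ω i)) (predErr (Gi ω) z)) _) _)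
  have e1 : Integrable (fun ω => predDist P B (G ω) (Gi ω)) μ := integrable_predDist hB hG hGi
  have e2 : Integrable (fun ω => predDist P B (Gi ω) (H ω)) μ := integrable_predDist hB hGi hH
  refine (integral_mono_of_nonneg (ae_of_all _ fun ω => integral_nonneg fun z => abs_nonneg _)
    ((e1.add hΨi).add e2) (ae_of_all _ hpt)).trans ?_
  rw [integral_add' (e1.add hΨi) e2, integral_add' e1 hΨi]
  linarith

lemma abs_leInd_sub_errCDF_le_one (a b : ℝ) (g : Vec p → ℝ) (t : ℝ) :
    |leInd a b - errCDF P g t| ≤ 1 := by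
  rw [abs_le]
  constructor <;>
  linarith [leInd_nonneg a b, leInd_le_one a b, errCDF_nonneg (P := P) g t,
    errCDF_le_one (P := P) g t]

/-- Given a predictor not depending on the observations `i ≠ j`, the centred indicators of the
two corresponding residuals are uncorrelated. -/
lemma integral_mul_leInd_sub_errCDF_eq_zero {H : (κ → Obs p) → Vec p → ℝ}
    (hH : Measurable (Function.uncurry H)) {i j : κ} (hij : i ≠ j)
    (hH_inv : ∀ ω y, H (Function.update ω i y) = H ω) :
    ∫ ω, ∫ z, (leInd (predErr (H ω) (ω i)) (predErr (H ω) z) - errCDF P (H ω) (predErr (H ω) z))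
      * (leInd (predErr (H ω) (ω j)) (predErr (H ω) z) - errCDF P (H ω) (predErr (H ω) z)) ∂P
      ∂(Measure.pi fun _ : κ => P) = 0 := by
  let Φ : (κ → Obs p) → Obs p → ℝ := fun ω y =>
    ∫ z, (leInd (predErr (H ω) y) (predErr (H ω) z) - errCDF P (H ω) (predErr (H ω) z))
      * (leInd (predErr (H ω) (ω j)) (predErr (H ω) z) - errCDF P (H ω) (predErr (H ω) z)) ∂P
  have hb : ∀ ω y z, |(leInd (predErr (H ω) y) (predErr (H ω) z)
      - errCDF P (H ω) (predErr (H ω) z)) * (leInd (predErr (H ω) (ω j)) (predErr (H ω) z)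
        - errCDF P (H ω) (predErr (H ω) z))| ≤ 1 := fun ω y z => by
    rw [abs_mul]
    exact mul_le_one₀ (abs_leInd_sub_errCDF_le_one _ _ _ _) (abs_nonneg _)
      (abs_leInd_sub_errCDF_le_one _ _ _ _)
  have hjoint : Measurable fun q : ((κ → Obs p) × Obs p) × Obs p =>
      (leInd (predErr (H q.1.1) q.1.2) (predErr (H q.1.1) q.2)
        - errCDF P (H q.1.1) (predErr (H q.1.1) q.2))
      * (leInd (predErr (H q.1.1) (q.1.1 j)) (predErr (H q.1.1) q.2)
        - errCDF P (H q.1.1) (predErr (H q.1.1) q.2)) := by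
    have h1 : Measurable fun q : ((κ → Obs p) × Obs p) × Obs p => predErr (H q.1.1) q.1.2 :=
      hH.predErr' measurable_fst.fst measurable_fst.snd
    have h2 : Measurable fun q : ((κ → Obs p) × Obs p) × Obs p => predErr (H q.1.1) q.2 :=
      hH.predErr' measurable_fst.fst measurable_snd
    have h3 : Measurable fun q : ((κ → Obs p) × Obs p) × Obs p =>
        predErr (H q.1.1) (q.1.1 j) :=
      hH.predErr' measurable_fst.fst ((measurable_pi_apply j).comp measurable_fst.fst)
    have h4 : Measurable fun q : ((κ → Obs p) × Obs p) × Obs p =>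
        errCDF P (H q.1.1) (predErr (H q.1.1) q.2) := Measurable.errCDF' P hH measurable_fst.fst h2
    exact ((h1.leInd' h2).sub h4).mul ((h3.leInd' h2).sub h4)
  have hΦm : Measurable (Function.uncurry Φ) := measurable_integral_param P hjoint
  have hΦ1 : ∀ ω y, |Φ ω y| ≤ 1 := fun ω y => abs_integral_le_one (hb ω y)
  have hΦinv : ∀ ω y, Φ (Function.update ω i y) = Φ ω := fun ω y => by
    ext; simp only [Φ, hH_inv, Function.update_of_ne hij.symm]
  have := integral_pi_resample (P := P) i hΦm 1 hΦ1 hΦinv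
  refine this.trans (integral_eq_zero_of_ae (ae_of_all _ fun ω => ?_))
  have hHm : Measurable (H ω) := hH.comp measurable_prodMk_left
  simp only [Φ, Pi.zero_apply]
  have hsec : Measurable (Function.uncurry fun y z =>
      (leInd (predErr (H ω) y) (predErr (H ω) z) - errCDF P (H ω) (predErr (H ω) z))
      * (leInd (predErr (H ω) (ω j)) (predErr (H ω) z)
        - errCDF P (H ω) (predErr (H ω) z))) :=
    hjoint.comp (((measurable_const (a := ω)).prodMk measurable_fst).prodMk measurable_snd)
  rw [integral_integral_swap (integrable_of_measurable_of_abs_le hsec 1 fun q => hb ω q.1 q.2)]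
  refine integral_eq_zero_of_ae (ae_of_all _ fun z => ?_)
  simp only [Pi.zero_apply]
  rw [integral_mul_const, integral_sub (integrable_leInd hHm _) (integrable_const _),
    ← errCDF_eq_integral P hHm]
  simp

lemma mul_sub_mul_le {a b F a' b' F' : ℝ} (h1 : |a - F| ≤ 1) (h2 : |b' - F'| ≤ 1) :
    (a - F) * (b - F) ≤ (a' - F') * (b' - F')
      + (|a - a'| + |b - b'| + 2 * |F - F'|) := by
  have e : (a - F) * (b - F) - (a' - F') * (b' - F')
      = (a - F) * ((b - b') - (F - F')) + (b' - F') * ((a - a') - (F - F')) := by ring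
  have k1 : (a - F) * ((b - b') - (F - F')) ≤ |b - b'| + |F - F'| := by
    refine (le_abs_self _).trans ?_
    rw [abs_mul]
    exact (mul_le_of_le_one_left (abs_nonneg _) h1).trans (abs_sub _ _)
  have k2 : (b' - F') * ((a - a') - (F - F')) ≤ |a - a'| + |F - F'| := by
    refine (le_abs_self _).trans ?_
    rw [abs_mul]
    exact (mul_le_of_le_one_left (abs_nonneg _) h2).trans (abs_sub _ _)
  linarith

/-- Bound on the covariance of two centred residual indicators, in terms of the distances of the
predictors involved to a common predictor `H` not depending on the observations `i ≠ j`. -/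
lemma integral_mul_leInd_sub_errCDF_le (hB : 0 ≤ B) (hP : SpreadErr P B)
    {G Gi Gj H : (κ → Obs p) → Vec p → ℝ} (hG : Measurable (Function.uncurry G))
    (hGi : Measurable (Function.uncurry Gi)) (hGj : Measurable (Function.uncurry Gj))
    (hH : Measurable (Function.uncurry H)) {i j : κ} (hij : i ≠ j)
    (hGi_inv : ∀ ω y, Gi (Function.update ω i y) = Gi ω)
    (hGj_inv : ∀ ω y, Gj (Function.update ω j y) = Gj ω)
    (hHi_inv : ∀ ω y, H (Function.update ω i y) = H ω)
    (hHj_inv : ∀ ω y, H (Function.update ω j y) = H ω) {δ : ℝ}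
    (hδi : ∫ ω, predDist P B (G ω) (Gi ω) ∂(Measure.pi fun _ : κ => P) ≤ δ)
    (hδj : ∫ ω, predDist P B (G ω) (Gj ω) ∂(Measure.pi fun _ : κ => P) ≤ δ)
    (hδiH : ∫ ω, predDist P B (Gi ω) (H ω) ∂(Measure.pi fun _ : κ => P) ≤ 2 * δ)
    (hδjH : ∫ ω, predDist P B (Gj ω) (H ω) ∂(Measure.pi fun _ : κ => P) ≤ 2 * δ) :
    ∫ ω, ∫ z, (leInd (predErr (Gi ω) (ω i)) (predErr (G ω) z) - errCDF P (G ω) (predErr (G ω) z))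
      * (leInd (predErr (Gj ω) (ω j)) (predErr (G ω) z) - errCDF P (G ω) (predErr (G ω) z)) ∂P
      ∂(Measure.pi fun _ : κ => P) ≤ 22 * δ := by
  set μ := Measure.pi fun _ : κ => P with hμ
  have hGm : ∀ ω, Measurable (G ω) := fun ω => hG.comp measurable_prodMk_left
  have hGim : ∀ ω, Measurable (Gi ω) := fun ω => hGi.comp measurable_prodMk_left
  have hHm : ∀ ω, Measurable (H ω) := fun ω => hH.comp measurable_prodMk_left
  have e1 : Integrable (fun ω => predDist P B (G ω) (Gi ω)) μ := integrable_predDist hB hG hGi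
  have e2 : Integrable (fun ω => predDist P B (Gi ω) (H ω)) μ := integrable_predDist hB hGi hH
  have e3 : Integrable (fun ω => predDist P B (G ω) (H ω)) μ := integrable_predDist hB hG hH
  have hGH : ∫ ω, predDist P B (G ω) (H ω) ∂μ ≤ 3 * δ := by
    refine (integral_mono e3 (e1.add e2) fun ω =>
      predDist_triangle hB (hGm ω) (hGim ω) (hHm ω)).trans ?_
    rw [integral_add' e1 e2]; linarith
  have hz : Measurable fun q : (κ → Obs p) × Obs p => predErr (G q.1) q.2 :=
    hG.predErr' measurable_fst measurable_snd
  have hz' : Measurable fun q : (κ → Obs p) × Obs p => predErr (H q.1) q.2 :=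
    hH.predErr' measurable_fst measurable_snd
  have hres : ∀ {K : (κ → Obs p) → Vec p → ℝ} (k : κ), Measurable (Function.uncurry K) →
      Measurable fun q : (κ → Obs p) × Obs p => predErr (K q.1) (q.1 k) := fun k hK =>
    hK.predErr' measurable_fst ((measurable_pi_apply k).comp measurable_fst)
  have hF := Measurable.errCDF' P hG measurable_fst hz
  have hF' := Measurable.errCDF' P hH measurable_fst hz'
  let a : (κ → Obs p) × Obs p → ℝ := fun q =>
    leInd (predErr (Gi q.1) (q.1 i)) (predErr (G q.1) q.2)
  let b : (κ → Obs p) × Obs p → ℝ := fun q =>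
    leInd (predErr (Gj q.1) (q.1 j)) (predErr (G q.1) q.2)
  let F : (κ → Obs p) × Obs p → ℝ := fun q => errCDF P (G q.1) (predErr (G q.1) q.2)
  let a' : (κ → Obs p) × Obs p → ℝ := fun q =>
    leInd (predErr (H q.1) (q.1 i)) (predErr (H q.1) q.2)
  let b' : (κ → Obs p) × Obs p → ℝ := fun q =>
    leInd (predErr (H q.1) (q.1 j)) (predErr (H q.1) q.2)
  let F' : (κ → Obs p) × Obs p → ℝ := fun q => errCDF P (H q.1) (predErr (H q.1) q.2)
  have ma : Measurable a := (hres i hGi).leInd' hz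
  have mb : Measurable b := (hres j hGj).leInd' hz
  have ma' : Measurable a' := (hres i hH).leInd' hz'
  have mb' : Measurable b' := (hres j hH).leInd' hz'
  have ia : Integrable (fun q => |a q - a' q|) (μ.prod P) :=
    integrable_of_measurable_of_abs_le (ma.sub ma').norm 1
      fun q => abs_abs_leInd_sub_le_one _ _ _ _
  have ib : Integrable (fun q => |b q - b' q|) (μ.prod P) :=
    integrable_of_measurable_of_abs_le (mb.sub mb').norm 1
      fun q => abs_abs_leInd_sub_le_one _ _ _ _
  have iF : Integrable (fun q => |F q - F' q|) (μ.prod P) :=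
    integrable_of_measurable_of_abs_le (hF.sub hF').norm 1 fun q => by
      rw [abs_abs, abs_le]
      constructor <;>
      linarith [errCDF_nonneg (P := P) (G q.1) (predErr (G q.1) q.2),
        errCDF_le_one (P := P) (G q.1) (predErr (G q.1) q.2),
        errCDF_nonneg (P := P) (H q.1) (predErr (H q.1) q.2),
        errCDF_le_one (P := P) (H q.1) (predErr (H q.1) q.2)]
  have hprod1 : ∀ {x y t : ℝ}, |x - t| ≤ 1 → |y - t| ≤ 1 → |(x - t) * (y - t)| ≤ 1 :=
    fun h1 h2 => by rw [abs_mul]; exact mul_le_one₀ h1 (abs_nonneg _) h2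
  have i0 : Integrable (fun q => (a q - F q) * (b q - F q)) (μ.prod P) :=
    integrable_of_measurable_of_abs_le ((ma.sub hF).mul (mb.sub hF)) 1 fun q =>
      hprod1 (abs_leInd_sub_errCDF_le_one _ _ _ _) (abs_leInd_sub_errCDF_le_one _ _ _ _)
  have i1 : Integrable (fun q => (a' q - F' q) * (b' q - F' q)) (μ.prod P) :=
    integrable_of_measurable_of_abs_le ((ma'.sub hF').mul (mb'.sub hF')) 1 fun q =>
      hprod1 (abs_leInd_sub_errCDF_le_one _ _ _ _) (abs_leInd_sub_errCDF_le_one _ _ _ _)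
  have ha : ∫ q, |a q - a' q| ∂(μ.prod P) ≤ 5 * δ := by
    rw [integral_prod _ ia]
    refine (integral_abs_leInd_sub_le hB hP hG hGi hH i hGi_inv hHi_inv).trans ?_
    linarith
  have hb : ∫ q, |b q - b' q| ∂(μ.prod P) ≤ 5 * δ := by
    rw [integral_prod _ ib]
    refine (integral_abs_leInd_sub_le hB hP hG hGj hH j hGj_inv hHj_inv).trans ?_
    linarith
  have hFF : ∫ q, |F q - F' q| ∂(μ.prod P) ≤ 6 * δ := by
    rw [integral_prod _ iF]
    refine (integral_mono_of_nonneg (ae_of_all _ fun ω => integral_nonneg fun z => abs_nonneg _)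
      (e3.const_mul 2) (ae_of_all _ fun ω =>
        integral_abs_errCDF_predErr_le hB hP (hGm ω) (hHm ω))).trans ?_
    rw [integral_const_mul]; linarith
  have h0 : ∫ q, (a' q - F' q) * (b' q - F' q) ∂(μ.prod P) = 0 := by
    rw [integral_prod _ i1]
    exact integral_mul_leInd_sub_errCDF_eq_zero hH hij hHi_inv
  have hmain : ∫ q, (a q - F q) * (b q - F q) ∂(μ.prod P) ≤ 22 * δ := by
    have hle := integral_mono i0 (i1.add ((ia.add ib).add (iF.const_mul 2))) fun q =>
      mul_sub_mul_le (abs_leInd_sub_errCDF_le_one (P := P) _ _ _ _)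
        (abs_leInd_sub_errCDF_le_one (P := P) _ _ _ _)
    rw [integral_add' i1 ((ia.add ib).add (iF.const_mul 2)),
      integral_add' (ia.add ib) (iF.const_mul 2), integral_add' ia ib,
      integral_const_mul] at hle
    linarith
  rwa [integral_prod _ i0] at hmain

end Pair
section Erase

variable {Z : Type*} {n : ℕ}

lemma erase1_congr {T T' : Fin n → Z} {i : Fin n} (h : ∀ k ≠ i, T k = T' k) :
    erase1 T i = erase1 T' i := by
  ext j
  simp only [erase1]
  split_ifs with hj <;> exact h _ (by rw [Ne, Fin.ext_iff]; simp only; omega)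

lemma erase1_eq_succAbove {m : ℕ} (T : Fin (m + 1) → Z) (i : Fin (m + 1)) :
    erase1 T i = fun j : Fin m => T (i.succAbove j) := by
  ext j
  simp only [erase1, Fin.succAbove, Fin.lt_def, Fin.val_castSucc]
  split_ifs <;> rfl

lemma exists_erase1_comp_perm (T : Fin n → Z) (τ : Equiv.Perm (Fin n)) (j : Fin n) :
    ∃ π : Equiv.Perm (Fin (n - 1)), erase1 (T ∘ τ) j = erase1 T (τ j) ∘ π := by
  obtain ⟨m, rfl⟩ : ∃ m, n = m + 1 := ⟨n - 1, by have := j.isLt; omega⟩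
  let π : Equiv.Perm (Fin m) := (finSuccAboveEquiv j).trans
    ((τ.subtypeEquiv fun a => by simp).trans (finSuccAboveEquiv (τ j)).symm)
  refine ⟨π, ?_⟩
  rw [erase1_eq_succAbove, erase1_eq_succAbove]
  ext k
  have h : (finSuccAboveEquiv (τ j) (π k) : Fin (m + 1)) = τ (j.succAbove k) := by
    simp [π, finSuccAboveEquiv_apply]
  simp only [Function.comp_apply]
  rw [← h]
  rfl

lemma measurable_erase1 [MeasurableSpace Z] (i : Fin n) :
    Measurable fun T : Fin n → Z => erase1 T i := by
  refine measurable_pi_lambda _ fun j => ?_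
  simp only [erase1]
  split_ifs <;> exact measurable_pi_apply _

lemma measurable_train [MeasurableSpace Z] :
    Measurable fun ω : Fin (n + 1) → Z => train ω :=
  measurable_pi_lambda _ fun _ => measurable_pi_apply _

lemma train_update_succ (ω : Fin (n + 1) → Z) (i : Fin n) (y : Z) :
    train (Function.update ω i.succ y) = Function.update (train ω) i y := by
  ext k
  by_cases hk : k = i
  · subst hk; simp [train]
  · have : k.succ ≠ i.succ := fun h => hk (Fin.succ_injective _ h)
    simp [train, Function.update_of_ne hk, Function.update_of_ne this]

lemma train_update_zero (ω : Fin (n + 1) → Z) (y : Z) :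
    train (Function.update ω 0 y) = train ω := by
  ext k; simp [train]

lemma train_comp_swap (ω : Fin (n + 1) → Z) (i : Fin n) :
    train (ω ∘ Equiv.swap 0 i.succ) = Function.update (train ω) i (ω 0) := by
  ext k
  by_cases hk : k = i
  · subst hk; simp [train]
  · have : k.succ ≠ i.succ := fun h => hk (Fin.succ_injective _ h)
    simp [train, Function.update_of_ne hk,
      Equiv.swap_apply_of_ne_of_ne (Fin.succ_ne_zero k) this]

lemma erase1_update_self (T : Fin n → Z) (i : Fin n) (y : Z) :
    erase1 (Function.update T i y) i = erase1 T i :=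
  erase1_congr fun _ hk => Function.update_of_ne hk _ _

lemma exists_erase1_update_perm (T : Fin n → Z) {i j : Fin n} (hij : i ≠ j) (y : Z) :
    ∃ π : Equiv.Perm (Fin (n - 1)),
      erase1 (Function.update T i y) j = erase1 (Function.update T j y) i ∘ π := by
  obtain ⟨π, hπ⟩ := exists_erase1_comp_perm (Function.update T j y) (Equiv.swap i j) j
  rw [Equiv.swap_apply_right] at hπ
  refine ⟨π, hπ ▸ erase1_congr fun k hk => ?_⟩
  by_cases hki : k = i
  · subst hki; simp
  · simp [Function.update_of_ne hki, Equiv.swap_apply_of_ne_of_ne hki hk,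
      Function.update_of_ne hk]

end Erase

section Stability

variable {p n : ℕ} {P : Measure (Obs p)} [IsProbabilityMeasure P] {B δ : ℝ}
  {Mfull : (Fin n → Obs p) → Vec p → ℝ} {Mloo : (Fin (n - 1) → Obs p) → Vec p → ℝ}

/-- Stability at sample size `n`: dropping any one training pair changes the predictor by at
most `δ` in mean truncated distance. -/
def MeanStable {p n : ℕ} (P : Measure (Obs p)) (B δ : ℝ)
    (Mfull : (Fin n → Obs p) → Vec p → ℝ) (Mloo : (Fin (n - 1) → Obs p) → Vec p → ℝ) : Prop :=
  ∀ k : Fin n, ∫ ω : Fin (n + 1) → Obs p,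
    min (B * |Mfull (train ω) (ω 0).1 - Mloo (erase1 (train ω) k) (ω 0).1|) 1
      ∂(Measure.pi fun _ : Fin (n + 1) => P) ≤ δ

lemma MeanStable.integral_predDist_le (hB : 0 ≤ B) (h : MeanStable P B δ Mfull Mloo)
    (hf : Measurable (Function.uncurry Mfull)) (hl : Measurable (Function.uncurry Mloo))
    (k : Fin n) :
    ∫ ω : Fin (n + 1) → Obs p, predDist P B (Mfull (train ω)) (Mloo (erase1 (train ω) k))
      ∂(Measure.pi fun _ : Fin (n + 1) => P) ≤ δ := by
  refine le_trans (le_of_eq ?_) (h k)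
  let Φ : (Fin (n + 1) → Obs p) → Obs p → ℝ := fun ω z =>
    min (B * |Mfull (train ω) z.1 - Mloo (erase1 (train ω) k) z.1|) 1
  have hΦ : Measurable (Function.uncurry Φ) := by
    have h1 : Measurable fun q : (Fin (n + 1) → Obs p) × Obs p => Mfull (train q.1) q.2.1 :=
      hf.comp ((measurable_train.comp measurable_fst).prodMk measurable_snd.fst)
    have h2 : Measurable fun q : (Fin (n + 1) → Obs p) × Obs p =>
        Mloo (erase1 (train q.1) k) q.2.1 :=
      hl.comp (((measurable_erase1 k).comp (measurable_train.comp measurable_fst)).prodMk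
        measurable_snd.fst)
    exact (measurable_const.mul (h1.sub h2).norm).min measurable_const
  exact (integral_pi_resample 0 hΦ 1 (fun ω z => abs_min_one_le (by positivity)) fun ω y => by
    ext; simp only [Φ, train_update_zero]).symm

lemma MeanStable.integral_predDist_update_le (hB : 0 ≤ B) (h : MeanStable P B δ Mfull Mloo)
    (hf : Measurable (Function.uncurry Mfull)) (hl : Measurable (Function.uncurry Mloo))
    (i k : Fin n) :
    ∫ ω : Fin (n + 1) → Obs p, predDist P B (Mfull (Function.update (train ω) i (ω 0)))
      (Mloo (erase1 (Function.update (train ω) i (ω 0)) k))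
      ∂(Measure.pi fun _ : Fin (n + 1) => P) ≤ δ := by
  refine le_trans (le_of_eq ?_) (h.integral_predDist_le hB hf hl k)
  have hmp := measurePreserving_pi_comp (P := P) (Equiv.swap 0 i.succ).injective
  have hm : Measurable fun ω : Fin (n + 1) → Obs p =>
      predDist P B (Mfull (train ω)) (Mloo (erase1 (train ω) k)) :=
    Measurable.predDist' P B (hf.predictor measurable_train)
      (hl.predictor ((measurable_erase1 k).comp measurable_train))
  conv_rhs => rw [← hmp.map_eq]
  rw [integral_map hmp.measurable.aemeasurable hm.aestronglyMeasurable]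
  simp only [train_comp_swap]

/-- Mean squared deviation, under the law of the prediction error, of the empirical distribution
function of the leave-one-out residuals from the distribution function it estimates. -/
def looSqDev (P : Measure (Obs p)) (Mfull : (Fin n → Obs p) → Vec p → ℝ)
    (Mloo : (Fin (n - 1) → Obs p) → Vec p → ℝ) (T : Fin n → Obs p) : ℝ :=
  ∫ z, (empCDF (looResid Mloo T) (predErr (Mfull T) z)
    - errCDF P (Mfull T) (predErr (Mfull T) z)) ^ 2 ∂P

lemma empCDF_looResid_eq (T : Fin n → Obs p) (s : ℝ) :
    empCDF (looResid Mloo T) s = (∑ i, leInd (predErr (Mloo (erase1 T i)) (T i)) s) / n := by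
  simp only [empCDF, leInd, Finset.sum_boole]
  rfl

lemma measurable_looSqDev_integrand (hf : Measurable (Function.uncurry Mfull))
    (hl : Measurable (Function.uncurry Mloo)) :
    Measurable fun q : (Fin n → Obs p) × Obs p =>
      (empCDF (looResid Mloo q.1) (predErr (Mfull q.1) q.2)
        - errCDF P (Mfull q.1) (predErr (Mfull q.1) q.2)) ^ 2 := by
  have hz : Measurable fun q : (Fin n → Obs p) × Obs p => predErr (Mfull q.1) q.2 :=
    hf.predErr' measurable_fst measurable_snd
  simp only [empCDF_looResid_eq]
  refine (Measurable.sub (Measurable.div_const (Finset.measurable_sum _ fun i _ => ?_) _)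
    (Measurable.errCDF' P hf measurable_fst hz)).pow_const 2
  exact (hl.predErr' ((measurable_erase1 i).comp measurable_fst)
    ((measurable_pi_apply i).comp measurable_fst)).leInd' hz

lemma abs_looSqDev_integrand_le (T : Fin n → Obs p) (t : ℝ) :
    |(empCDF (looResid Mloo T) t - errCDF P (Mfull T) t) ^ 2| ≤ 1 := by
  rw [abs_pow]
  exact pow_le_one₀ (abs_nonneg _) (abs_empCDF_sub_errCDF_le_one _ _ _ _)

lemma measurable_looSqDev (hf : Measurable (Function.uncurry Mfull))
    (hl : Measurable (Function.uncurry Mloo)) : Measurable (looSqDev P Mfull Mloo) :=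
  measurable_integral_param P (measurable_looSqDev_integrand hf hl)

lemma integrable_looSqDev {μ : Measure (Fin n → Obs p)} [IsFiniteMeasure μ]
    (hf : Measurable (Function.uncurry Mfull)) (hl : Measurable (Function.uncurry Mloo)) :
    Integrable (looSqDev P Mfull Mloo) μ :=
  integrable_of_measurable_of_abs_le (measurable_looSqDev hf hl) 1 fun _ =>
    abs_integral_le_one fun _ => abs_looSqDev_integrand_le _ _

lemma MeanStable.integral_mul_le (hB : 0 ≤ B) (hP : SpreadErr P B)
    (h : MeanStable P B δ Mfull Mloo) (hf : Measurable (Function.uncurry Mfull))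
    (hl : Measurable (Function.uncurry Mloo)) (hsym : SymmetricAlg Mfull Mloo) {i j : Fin n}
    (hij : i ≠ j) :
    ∫ ω : Fin (n + 1) → Obs p, ∫ z,
      (leInd (predErr (Mloo (erase1 (train ω) i)) (train ω i)) (predErr (Mfull (train ω)) z)
        - errCDF P (Mfull (train ω)) (predErr (Mfull (train ω)) z))
      * (leInd (predErr (Mloo (erase1 (train ω) j)) (train ω j)) (predErr (Mfull (train ω)) z)
        - errCDF P (Mfull (train ω)) (predErr (Mfull (train ω)) z)) ∂P
      ∂(Measure.pi fun _ : Fin (n + 1) => P) ≤ 22 * δ := by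
  let H : Fin n → Fin n → (Fin (n + 1) → Obs p) → Vec p → ℝ := fun i j ω =>
    Mloo (erase1 (Function.update (train ω) i (ω 0)) j)
  have hupd : ∀ i : Fin n, Measurable fun ω : Fin (n + 1) → Obs p =>
      Function.update (train ω) i (ω 0) := fun i => by
    simp only [← train_comp_swap]
    exact measurable_pi_lambda _ fun _ => measurable_pi_apply _
  have hG : Measurable (Function.uncurry fun ω : Fin (n + 1) → Obs p => Mfull (train ω)) :=
    hf.predictor measurable_train
  have hGk : ∀ k, Measurable
      (Function.uncurry fun ω : Fin (n + 1) → Obs p => Mloo (erase1 (train ω) k)) := fun k =>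
    hl.predictor ((measurable_erase1 k).comp measurable_train)
  have hGu : ∀ i, Measurable (Function.uncurry fun ω : Fin (n + 1) → Obs p =>
      Mfull (Function.update (train ω) i (ω 0))) := fun i => hf.predictor (hupd i)
  have hH : ∀ i j, Measurable (Function.uncurry (H i j)) := fun i j =>
    hl.predictor ((measurable_erase1 j).comp (hupd i))
  have hHsymm : ∀ {i j}, i ≠ j → H i j = H j i := fun {i j} hij => by
    ext ω x
    obtain ⟨π, hπ⟩ := exists_erase1_update_perm (train ω) hij (ω 0)
    simp only [H, hπ]
    exact hsym.2 _ _ _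
  have hHinv : ∀ (i j : Fin n) ω y, H i j (Function.update ω i.succ y) = H i j ω := by
    intro i j ω y
    simp only [H, train_update_succ, Function.update_idem,
      Function.update_of_ne (Fin.succ_ne_zero i).symm]
  have hGinv : ∀ (i : Fin n) (ω : Fin (n + 1) → Obs p) y,
      Mloo (erase1 (train (Function.update ω i.succ y)) i) = Mloo (erase1 (train ω) i) :=
    fun i ω y => by rw [train_update_succ, erase1_update_self]
  have hdist : ∀ i j : Fin n, ∫ ω, predDist P B (Mloo (erase1 (train ω) i)) (H i j ω)
      ∂(Measure.pi fun _ : Fin (n + 1) => P) ≤ 2 * δ := by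
    intro i j
    have h1 := h.integral_predDist_update_le hB hf hl i i
    have h2 := h.integral_predDist_update_le hB hf hl i j
    simp only [erase1_update_self] at h1
    have e1 := integrable_predDist (P := P) (μ := Measure.pi fun _ : Fin (n + 1) => P) hB
      (hGu i) (hGk i)
    have e2 := integrable_predDist (P := P) (μ := Measure.pi fun _ : Fin (n + 1) => P) hB
      (hGu i) (hH i j)
    refine (integral_mono (integrable_predDist hB (hGk i) (hH i j)) (e1.add e2) fun ω => ?_).trans
      (?_ : _ ≤ 2 * δ)
    · refine (predDist_triangle hB (b := Mfull (Function.update (train ω) i (ω 0)))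
        ((hGk i).comp (measurable_prodMk_left (x := ω)))
        ((hGu i).comp (measurable_prodMk_left (x := ω)))
        ((hH i j).comp (measurable_prodMk_left (x := ω)))).trans ?_
      rw [predDist_comm]
      rfl
    · rw [integral_add' e1 e2]
      linarith
  exact integral_mul_leInd_sub_errCDF_le hB hP (i := i.succ) (j := j.succ) hG (hGk i) (hGk j)
    (hH i j) (fun hc => hij (Fin.succ_injective _ hc)) (hGinv i) (hGinv j) (hHinv i j)
    (by rw [hHsymm hij]; exact hHinv j i) (h.integral_predDist_le hB hf hl i)
    (h.integral_predDist_le hB hf hl j) (hdist i j) (by rw [hHsymm hij]; exact hdist j i)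

lemma MeanStable.integral_looSqDev_le (hn : 0 < n) (hB : 0 ≤ B) (hδ : 0 ≤ δ)
    (hP : SpreadErr P B) (h : MeanStable P B δ Mfull Mloo)
    (hf : Measurable (Function.uncurry Mfull)) (hl : Measurable (Function.uncurry Mloo))
    (hsym : SymmetricAlg Mfull Mloo) :
    ∫ T, looSqDev P Mfull Mloo T ∂(Measure.pi fun _ : Fin n => P) ≤ 1 / n + 22 * δ := by
  have hn' : (0 : ℝ) < n := by exact_mod_cast hn
  obtain ⟨μ, hμ⟩ : ∃ μ, μ = Measure.pi fun _ : Fin (n + 1) => P := ⟨_, rfl⟩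
  have : IsProbabilityMeasure μ := hμ ▸ inferInstance
  have hmp : MeasurePreserving (fun ω : Fin (n + 1) → Obs p => train ω) μ
      (Measure.pi fun _ : Fin n => P) :=
    hμ ▸ measurePreserving_pi_comp (P := P) (Fin.succ_injective n)
  rw [← hmp.map_eq, integral_map hmp.measurable.aemeasurable
    (measurable_looSqDev hf hl).aestronglyMeasurable]
  let c : Fin n → (Fin (n + 1) → Obs p) × Obs p → ℝ := fun i q =>
    leInd (predErr (Mloo (erase1 (train q.1) i)) (train q.1 i)) (predErr (Mfull (train q.1)) q.2)
      - errCDF P (Mfull (train q.1)) (predErr (Mfull (train q.1)) q.2)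
  have hc1 : ∀ i q, |c i q| ≤ 1 := fun i q => abs_leInd_sub_errCDF_le_one _ _ _ _
  have hcm : ∀ i, Measurable (c i) := fun i => by
    have ht : Measurable fun q : (Fin (n + 1) → Obs p) × Obs p => train q.1 :=
      measurable_train.comp measurable_fst
    have hz : Measurable fun q : (Fin (n + 1) → Obs p) × Obs p =>
        predErr (Mfull (train q.1)) q.2 := hf.predErr' ht measurable_snd
    exact ((hl.predErr' ((measurable_erase1 i).comp ht)
      ((measurable_pi_apply i).comp ht)).leInd' hz).sub (Measurable.errCDF' P hf ht hz)
  have hcc : ∀ i j, Integrable (fun q => c i q * c j q) (μ.prod P) := fun i j =>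
    integrable_of_measurable_of_abs_le ((hcm i).mul (hcm j)) 1 fun q => by
      rw [abs_mul]; exact mul_le_one₀ (hc1 i q) (abs_nonneg _) (hc1 j q)
  have hcov : ∀ i j, ∫ q, c i q * c j q ∂(μ.prod P) ≤ (if i = j then 1 else 0) + 22 * δ := by
    intro i j
    split_ifs with hij
    · have : ∫ q, c i q * c j q ∂(μ.prod P) ≤ ∫ _, (1 : ℝ) ∂(μ.prod P) :=
        integral_mono (hcc i j) (integrable_const _) fun q => (le_abs_self _).trans (by
          rw [abs_mul]; exact mul_le_one₀ (hc1 i q) (abs_nonneg _) (hc1 j q))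
      simp only [integral_const, probReal_univ, smul_eq_mul, mul_one] at this
      linarith
    · rw [integral_prod _ (hcc i j), zero_add]
      exact hμ ▸ h.integral_mul_le hB hP hf hl hsym hij
  have hexp : ∀ ω z, (empCDF (looResid Mloo (train ω)) (predErr (Mfull (train ω)) z)
      - errCDF P (Mfull (train ω)) (predErr (Mfull (train ω)) z)) ^ 2
      = (∑ i, ∑ j, c i (ω, z) * c j (ω, z)) / (n : ℝ) ^ 2 := by
    intro ω z
    rw [empCDF_looResid_eq, ← Finset.sum_mul_sum, ← sq, ← div_pow]
    congr 1
    simp only [c, Finset.sum_sub_distrib, Finset.sum_const, Finset.card_univ, Fintype.card_fin,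
      nsmul_eq_mul]
    field_simp
  have hsum : Integrable (fun q => (∑ i, ∑ j, c i q * c j q) / (n : ℝ) ^ 2) (μ.prod P) :=
    (integrable_finsetSum _ fun i _ => integrable_finsetSum _ fun j _ => hcc i j).div_const _
  have hQ : ∫ ω, looSqDev P Mfull Mloo (train ω) ∂μ
      = ∫ q, (∑ i, ∑ j, c i q * c j q) / (n : ℝ) ^ 2 ∂(μ.prod P) := by
    rw [integral_prod _ hsum]
    simp only [looSqDev, hexp]
  rw [hQ, integral_div, integral_finsetSum _ fun i _ => integrable_finsetSum _ fun j _ => hcc i j]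
  simp only [integral_finsetSum _ fun j _ => hcc _ j]
  have hle : ∑ i, ∑ j, ∫ q, c i q * c j q ∂(μ.prod P) ≤ n + (n : ℝ) ^ 2 * (22 * δ) := by
    refine (Finset.sum_le_sum fun i _ => Finset.sum_le_sum fun j _ => hcov i j).trans ?_
    simp [Finset.sum_add_distrib]
    apply le_of_eq; ring
  calc _ ≤ (n + (n : ℝ) ^ 2 * (22 * δ)) / (n : ℝ) ^ 2 := by gcongr
    _ = 1 / n + 22 * δ := by field_simp

/-- Finite-sample bound for the leave-one-out estimate of the prediction-error distribution. -/
lemma MeanStable.integral_iSup_le (hn : 0 < n) (hB : 0 ≤ B) (hδ : 0 ≤ δ)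
    (hP : SpreadErr P B) (h : MeanStable P B δ Mfull Mloo)
    (hf : Measurable (Function.uncurry Mfull)) (hl : Measurable (Function.uncurry Mloo))
    (hsym : SymmetricAlg Mfull Mloo) {ε : ℝ} (hε : 0 < ε) {φ : (Fin n → Obs p) → ℝ} {K : ℝ}
    (hK : 0 ≤ K) (hφ0 : ∀ T, 0 ≤ φ T)
    (hφ : ∀ T, φ T ≤ K * ⨆ s, |empCDF (looResid Mloo T) s - errCDF P (Mfull T) s|) :
    ∫ T, φ T ∂(Measure.pi fun _ : Fin n => P) ≤ K * (2 * ε + (1 / n + 22 * δ) / ε ^ 3) := by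
  have hi : Integrable (looSqDev P Mfull Mloo) (Measure.pi fun _ : Fin n => P) :=
    integrable_looSqDev hf hl
  calc _ ≤ ∫ T, K * (2 * ε + looSqDev P Mfull Mloo T / ε ^ 3)
          ∂(Measure.pi fun _ : Fin n => P) := by
        refine integral_mono_of_nonneg (ae_of_all _ hφ0)
          (((integrable_const _).add (hi.div_const _)).const_mul K) (ae_of_all _ fun T => ?_)
        exact (hφ T).trans (mul_le_mul_of_nonneg_left (iSup_abs_empCDF_sub_errCDF_le hB hP
          (hf.comp measurable_prodMk_left) _ hε) hK)
    _ = K * (2 * ε + (∫ T, looSqDev P Mfull Mloo T ∂(Measure.pi fun _ : Fin n => P)) / ε ^ 3) := by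
        rw [integral_const_mul, integral_add (integrable_const _) (hi.div_const _), integral_div]
        simp
    _ ≤ _ := by
        gcongr
        exact h.integral_looSqDev_le hn hB hδ hP hf hl hsym

end Stability

lemma tendsto_zero_of_forall_le {x η : ℕ → ℝ} {K : ℝ} (hη : Tendsto η atTop (𝓝 0))
    (h0 : ∀ n, 0 ≤ x n)
    (h : ∀ ε : ℝ, 0 < ε → ∀ n : ℕ, 0 < n →
      x n ≤ K * (2 * ε + (1 / n + 22 * |η n|) / ε ^ 3)) : Tendsto x atTop (𝓝 0) := by
  rw [Metric.tendsto_atTop']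
  intro r hr
  have hε : 0 < r / (4 * (|K| + 1)) := by positivity
  set ε := r / (4 * (|K| + 1)) with hεd
  have hlim : Tendsto (fun n : ℕ => K * (2 * ε + (1 / (n : ℝ) + 22 * |η n|) / ε ^ 3)) atTop
      (𝓝 (K * (2 * ε + (0 + 22 * |(0 : ℝ)|) / ε ^ 3))) :=
    (((tendsto_one_div_atTop_nhds_zero_nat.add (hη.abs.const_mul 22)).div_const _).const_add
      _).const_mul K
  have hlt : K * (2 * ε + (0 + 22 * |(0 : ℝ)|) / ε ^ 3) < r := by
    have : ε * (4 * (|K| + 1)) = r := by rw [hεd]; field_simp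
    simp only [abs_zero, mul_zero, add_zero, zero_div]
    nlinarith [le_abs_self K, abs_nonneg K]
  obtain ⟨N, hN⟩ := eventually_atTop.1 (hlim.eventually (gt_mem_nhds hlt))
  refine ⟨N, fun n hn => ?_⟩
  rw [Real.dist_eq, sub_zero, abs_of_nonneg (h0 n)]
  exact (h ε hε n (by omega)).trans_lt (hN n hn.le)

/-- Corollary 1 of the paper: uniform asymptotic consistency of the
leave-one-out estimate of the prediction-error distribution and uniform asymptotic
conditional validity of the leave-one-out prediction interval. The classes `𝒫ₙ` are
presented as indexed families `(P n i)_{i : ι n}` of probability measures, together with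
their regression functions `mreg`, error densities `f`, and scale parameters `σ`. -/
theorem stmt2 (p : ℕ → ℕ) (ι : ℕ → Type*)
    (P : ∀ n : ℕ, ι n → Measure (Obs (p n)))
    (mreg : ∀ n : ℕ, ι n → (Vec (p n) → ℝ))
    (f : ∀ n : ℕ, ι n → (ℝ → ℝ))
    (σ : ∀ n : ℕ, ι n → ℝ)
    (hprob : ∀ n i, IsProbabilityMeasure (P n i))
    (hC1 : ∀ n i, IsC1 (P n i) (mreg n i) (f n i))
    (hσ : ∀ n i, 0 < σ n i)
    -- `sup_n sup_P ‖f_{u/σ_P,P}‖_∞ < ∞` :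
    (hfsup : ∃ C : ℝ, ∀ n i s, σ n i * f n i s ≤ C)
    (Mfull : ∀ n : ℕ, (Fin n → Obs (p n)) → Vec (p n) → ℝ)
    (Mloo : ∀ n : ℕ, (Fin (n - 1) → Obs (p n)) → Vec (p n) → ℝ)
    (hMfull : ∀ n, Measurable (Function.uncurry (Mfull n)))
    (hMloo : ∀ n, Measurable (Function.uncurry (Mloo n)))
    (hsym : ∀ n, SymmetricAlg (Mfull n) (Mloo n))
    -- `ηₙ`-stability with `ηₙ → 0` :
    (η : ℕ → ℝ) (hη0 : Tendsto η atTop (𝓝 0))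
    (hstable : ∀ (n : ℕ) (i : ι n) (k : Fin n),
      (∫ ω : Fin (n + 1) → Obs (p n),
          min ((⨆ s : ℝ, f n i s) * |Mfull n (train ω) (ω 0).1
              - Mloo n (erase1 (train ω) k) (ω 0).1|) 1
          ∂(Measure.pi fun _ : Fin (n + 1) => P n i)) ≤ η n)
    -- uniformly bounded (in probability) scaled estimation error :
    (hesterr : Tendsto (fun M : ℝ => Filter.limsup (fun n : ℕ =>
        ⨆ i : ι n, ((Measure.pi fun _ : Fin (n + 1) => P n i)
          {ω : Fin (n + 1) → Obs (p n) |
            M < |mreg n i (ω 0).1 - Mfull n (train ω) (ω 0).1| / σ n i}).toReal) atTop)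
      atTop (𝓝 0))
    -- uniform tightness of the scaled error densities `s ↦ σ f(σ s)` :
    (htight : ∀ ε : ℝ, 0 < ε → ∃ M : ℝ, ∀ n i,
      (∫ s in (Set.Icc (-M) M)ᶜ, σ n i * f n i (σ n i * s)) ≤ ε) :
    -- (i) uniform consistency of `F̂ₙ` for `F̃ₙ` :
    (Tendsto (fun n : ℕ => ⨆ i : ι n,
        ∫ T : Fin n → Obs (p n),
          (⨆ s : ℝ, |empCDF (looResid (Mloo n) T) s - errCDF (P n i) (Mfull n T) s|)
          ∂(Measure.pi fun _ : Fin n => P n i)) atTop (𝓝 0))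
    -- (ii) uniform asymptotic conditional validity of the leave-one-out prediction interval :
    ∧ (∀ α₁ α₂ : ℝ, 0 ≤ α₁ → α₁ < α₂ → α₂ ≤ 1 →
        Tendsto (fun n : ℕ => ⨆ i : ι n,
          ∫ T : Fin n → Obs (p n),
            |coverProb (P n i) (Mfull n T)
                (qhat (looResid (Mloo n) T) α₁) (qhat (looResid (Mloo n) T) α₂)
              - (α₂ - α₁)|
            ∂(Measure.pi fun _ : Fin n => P n i)) atTop (𝓝 0)) := by
  have hB : ∀ n i, 0 ≤ ⨆ s, f n i s := fun n i => Real.iSup_nonneg (hC1 n i).2.1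
  have hP : ∀ n i, SpreadErr (P n i) (⨆ s, f n i s) := fun n i => (hC1 n i).spreadErr
  have hst : ∀ n i, MeanStable (P n i) (⨆ s, f n i s) |η n| (Mfull n) (Mloo n) :=
    fun n i k => (hstable n i k).trans (le_abs_self _)
  have key : ∀ (K : ℝ), 0 ≤ K → ∀ φ : ∀ n, ι n → (Fin n → Obs (p n)) → ℝ,
      (∀ n i T, 0 ≤ φ n i T) →
      (∀ n i T, 0 < n → φ n i T ≤ K * ⨆ s, |empCDF (looResid (Mloo n) T) s
        - errCDF (P n i) (Mfull n T) s|) →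
      Tendsto (fun n : ℕ => ⨆ i : ι n, ∫ T : Fin n → Obs (p n), φ n i T
        ∂(Measure.pi fun _ : Fin n => P n i)) atTop (𝓝 0) := by
    intro K hK φ h0 hφ
    refine tendsto_zero_of_forall_le (K := K) hη0
      (fun n => Real.iSup_nonneg fun i => integral_nonneg (h0 n i)) fun ε hε n hn => ?_
    refine Real.iSup_le (fun i => ?_) (by positivity)
    exact (hst n i).integral_iSup_le hn (hB n i) (abs_nonneg _) (hP n i) (hMfull n) (hMloo n)
      (hsym n) hε hK (h0 n i) fun T => hφ n i T hn
  refine ⟨key 1 zero_le_one _ (fun n i T => Real.iSup_nonneg fun s => abs_nonneg _)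
    fun n i T _ => (one_mul _).ge, fun α₁ α₂ h1 h12 h2 => ?_⟩
  exact key 2 zero_le_two _ (fun n i T => abs_nonneg _) fun n i T hn =>
    abs_coverProb_qhat_sub_le (hB n i) (hP n i) ((hMfull n).comp measurable_prodMk_left) hn _
      h1 h12.le h2

end
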